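/- arXiv:2602.04844 — 2 statements merged into one kernel-verified Lean document; each statement's English description precedes it below -/
import Mathlib

section
/- Let α > 0 and let f be a measurable function on (−1,1) belonging to the Zygmund space L_exp^α, i.e., there exists λ > 0 with ∫_{−1}^{1} exp(λ|f(x)|^{1/α}) dx < ∞. Then T(f) belongs to L_exp^{α+1}, i.e., there exists μ > 0 with ∫_{−1}^{1} exp(μ|T(f)(x)|^{1/(α+1)}) dx < ∞. -/
open MeasureTheory Filter Set

/-- Lebesgue measure restricted to the interval `(-1, 1)`. -/
noncomputable def mIoo : MeasureTheory.Measure ℝ :=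
  MeasureTheory.volume.restrict (Set.Ioo (-1 : ℝ) 1)

/-- The finite Hilbert transform: `T f t` is the principal value
`lim_{ε→0⁺} (1/π) (∫_{-1}^{t-ε} + ∫_{t+ε}^{1}) f x / (x - t) dx`. -/
noncomputable def FHT (f : ℝ → ℂ) (t : ℝ) : ℂ :=
  limUnder (nhdsWithin (0 : ℝ) (Set.Ioi 0)) fun ε =>
    (Real.pi : ℂ)⁻¹ * ((∫ x in Set.Ioo (-1 : ℝ) (t - ε), f x / (↑x - ↑t)) +
      ∫ x in Set.Ioo (t + ε) (1 : ℝ), f x / (↑x - ↑t))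

/-- `w x = √(1 - x²)`. -/
noncomputable def w (x : ℝ) : ℝ := Real.sqrt (1 - x ^ 2)

/-- The operator `Ť f = -w · T(f / w)`. -/
noncomputable def Tcheck (f : ℝ → ℂ) (t : ℝ) : ℂ :=
  -((w t : ℂ) * FHT (fun y => f y / (w y : ℂ)) t)

/-- The operator `T̂ f = -(1/w) · T(w f)`. -/
noncomputable def That (f : ℝ → ℂ) (t : ℝ) : ℂ :=
  -(FHT (fun y => (w y : ℂ) * f y) t / (w t : ℂ))

/-- Membership in the Zygmund space `L_exp^α`: `f` is measurable and there is `λ > 0` with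
`∫ exp(λ |f|^(1/α)) < ∞`. -/
def MemLexpPow (α : ℝ) (f : ℝ → ℂ) : Prop :=
  MeasureTheory.AEStronglyMeasurable f mIoo ∧
    ∃ l > (0 : ℝ),
      ∫⁻ x, ENNReal.ofReal (Real.exp (l * ‖f x‖ ^ ((1 : ℝ) / α))) ∂mIoo < ⊤

/-- Membership in the Zygmund space `L_exp`: `f` is measurable and there is `λ > 0` with
`∫ exp(λ |f|) < ∞`. -/
def MemLexp (f : ℝ → ℂ) : Prop :=
  MeasureTheory.AEStronglyMeasurable f mIoo ∧
    ∃ l > (0 : ℝ), ∫⁻ x, ENNReal.ofReal (Real.exp (l * ‖f x‖)) ∂mIoo < ⊤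

/-- Membership in the Zygmund space `L log L`: `g` is measurable and
`∫ |g| log(2 + |g|) < ∞`. -/
def MemLlogL (g : ℝ → ℂ) : Prop :=
  MeasureTheory.AEStronglyMeasurable g mIoo ∧
    MeasureTheory.Integrable (fun x => ‖g x‖ * Real.log (2 + ‖g x‖)) mIoo

lemma norm_add_pow_sub_pow_le (a b : ℂ) (n : ℕ) :
    ‖(a + b) ^ n - a ^ n‖ ≤ (‖a‖ + ‖b‖) ^ n - ‖a‖ ^ n := by
  induction n with
  | zero => simp
  | succ n ih =>
    have h : (a + b) ^ (n + 1) - a ^ (n + 1)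
        = (a + b) * ((a + b) ^ n - a ^ n) + b * a ^ n := by ring
    rw [h]
    calc ‖(a + b) * ((a + b) ^ n - a ^ n) + b * a ^ n‖
        ≤ ‖a + b‖ * ‖(a + b) ^ n - a ^ n‖ + ‖b‖ * ‖a‖ ^ n := by
          refine (norm_add_le _ _).trans (by simp)
      _ ≤ (‖a‖ + ‖b‖) * ((‖a‖ + ‖b‖) ^ n - ‖a‖ ^ n) + ‖b‖ * ‖a‖ ^ n := by
          gcongr
          exact norm_add_le _ _
      _ = _ := by ring

/-- The pointwise inequality behind the `L^n` bound for the conjugate function. -/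
lemma re_pow_le_of_even {n : ℕ} (hn : Even n) (h0 : 0 < n) (z : ℂ) :
    z.re ^ n ≤ 2 * (z ^ n).re + 3 * (4 * n) ^ n * |z.im| ^ n := by
  have hn0 : (0 : ℝ) < n := by exact_mod_cast h0
  have hn1 : (1 : ℝ) ≤ n := by exact_mod_cast h0
  have hP := abs_nonneg z.im
  rw [← hn.pow_abs, mul_assoc, ← mul_pow]
  rcases le_total |z.re| (3 * n * |z.im|) with h | h
  · have h1 : |(z ^ n).re| ≤ (4 * n * |z.im|) ^ n := by
      refine (Complex.abs_re_le_norm _).trans ?_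
      rw [norm_pow]
      gcongr
      refine (Complex.norm_le_abs_re_add_abs_im z).trans ?_
      nlinarith
    have h2 : |z.re| ^ n ≤ (4 * n * |z.im|) ^ n := by
      gcongr
      nlinarith
    linarith [neg_abs_le (z ^ n).re]
  · have h1 : |((z ^ n) - (z.re : ℂ) ^ n).re| ≤ (|z.re| + |z.im|) ^ n - |z.re| ^ n := by
      refine (Complex.abs_re_le_norm _).trans ?_
      have := norm_add_pow_sub_pow_le (z.re : ℂ) (z.im * Complex.I) n
      rw [Complex.re_add_im] at this
      simpa using this
    have h2 : (|z.re| + |z.im|) ^ n ≤ 3 / 2 * |z.re| ^ n := by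
      have h3 : |z.re| + |z.im| ≤ Real.exp (1 / (3 * n)) * |z.re| := by
        have := Real.add_one_le_exp (1 / (3 * (n : ℝ)))
        calc |z.re| + |z.im| ≤ |z.re| + |z.re| / (3 * n) := by
              gcongr
              rw [le_div_iff₀ (by positivity)]
              linarith
          _ = (1 / (3 * n) + 1) * |z.re| := by ring
          _ ≤ _ := by gcongr
      calc (|z.re| + |z.im|) ^ n ≤ (Real.exp (1 / (3 * n)) * |z.re|) ^ n := by gcongr
        _ = Real.exp (1 / 3) * |z.re| ^ n := by
          rw [mul_pow, ← Real.exp_nat_mul]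
          congr 2
          field_simp
        _ ≤ _ := by
          gcongr
          have h4 : Real.exp (1 / 3) ^ 3 ≤ (3 / 2) ^ 3 := by
            rw [← Real.exp_nat_mul]
            norm_num
            linarith [Real.exp_one_lt_d9]
          exact le_of_pow_le_pow_left₀ (by norm_num) (by norm_num) h4
    have h5 : ((z.re : ℂ) ^ n).re = |z.re| ^ n := by
      rw [hn.pow_abs, ← Complex.ofReal_pow, Complex.ofReal_re]
    rw [Complex.sub_re, h5] at h1
    have h6 : (0 : ℝ) ≤ (4 * n * |z.im|) ^ n := by positivity
    have := neg_abs_le ((z ^ n).re - |z.re| ^ n)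
    linarith

lemma lintegral_pow_le_lintegral_pow {Ω : Type*} [MeasurableSpace Ω] (μ : Measure Ω)
    [IsProbabilityMeasure μ] {φ : Ω → ENNReal} (hφ : AEMeasurable φ μ) {n : ℕ} (hn : 1 ≤ n) :
    (∫⁻ x, φ x ∂μ) ^ n ≤ ∫⁻ x, φ x ^ n ∂μ := by
  have hn' : (1 : ℝ) ≤ n := by exact_mod_cast hn
  have hn0 : (n : ℝ) ≠ 0 := by positivity
  have h := eLpNorm'_le_eLpNorm'_of_exponent_le one_pos hn' μ hφ.aestronglyMeasurable
  have h2 := ENNReal.rpow_le_rpow h n.cast_nonneg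
  rw [eLpNorm', eLpNorm', ← ENNReal.rpow_mul, ← ENNReal.rpow_mul, one_div_mul_cancel hn0] at h2
  simpa [ENNReal.rpow_natCast] using h2

open ProbabilityTheory in
/-- Poisson averages are `L^n`-contractions. -/
lemma lintegral_poisson_pow_le {ε : NNReal} (hε : ε ≠ 0) {φ : ℝ → ENNReal} (hφ : Measurable φ)
    {n : ℕ} (hn : 1 ≤ n) :
    ∫⁻ t, (∫⁻ x, cauchyPDF t ε x * φ x) ^ n ≤ ∫⁻ x, φ x ^ n := by
  have hm : Measurable (fun p : ℝ × ℝ => cauchyPDF p.1 ε p.2) := by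
    unfold cauchyPDF cauchyPDFReal
    fun_prop
  calc ∫⁻ t, (∫⁻ x, cauchyPDF t ε x * φ x) ^ n
      ≤ ∫⁻ t, ∫⁻ x, cauchyPDF t ε x * φ x ^ n := by
        refine lintegral_mono fun t => ?_
        have h := lintegral_pow_le_lintegral_pow (cauchyMeasure t ε) hφ.aemeasurable hn
        rw [cauchyMeasure_of_scale_ne_zero _ hε,
          lintegral_withDensity_eq_lintegral_mul _ (measurable_cauchyPDF _ _) hφ,
          lintegral_withDensity_eq_lintegral_mul _ (measurable_cauchyPDF _ _)
            (hφ.pow_const n)] at h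
        exact h
    _ = ∫⁻ x, ∫⁻ t, cauchyPDF t ε x * φ x ^ n := by
        refine lintegral_lintegral_swap (Measurable.aemeasurable ?_)
        exact hm.mul ((hφ.pow_const n).comp measurable_snd)
    _ = ∫⁻ x, φ x ^ n := by
        refine lintegral_congr fun x => ?_
        have hs : ∀ t, cauchyPDF t ε x = cauchyPDF x ε t := fun t => by
          rw [cauchyPDF_def, cauchyPDF_def, cauchyPDFReal_def, cauchyPDFReal_def, ← neg_sub t x, neg_sq]
        simp_rw [hs]
        rw [lintegral_mul_const _ (measurable_cauchyPDF _ _), lintegral_cauchyPDF_eq_one _ hε,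
          one_mul]

/-- The Cauchy transform `z ↦ ∫ g x / (x - z) dx`. -/
noncomputable def cauchyTransform (g : ℝ → ℝ) (z : ℂ) : ℂ :=
  ∫ x, (g x : ℂ) * ((x : ℂ) - z)⁻¹

lemma norm_cauchyTransform_le {g : ℝ → ℝ} (hg : Integrable g) {z : ℂ} {d : ℝ} (hd : 0 < d)
    (h : ∀ x, g x ≠ 0 → d ≤ ‖(x : ℂ) - z‖) : ‖cauchyTransform g z‖ ≤ (∫ x, |g x|) / d := by
  rw [← integral_div]
  refine norm_integral_le_of_norm_le (hg.abs.div_const d) (Eventually.of_forall fun x => ?_)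
  by_cases hx : g x = 0
  · simp [hx]
  · rw [norm_mul, norm_inv, Complex.norm_real, Real.norm_eq_abs, ← div_eq_mul_inv]
    gcongr
    exact h x hx

lemma im_le_norm_ofReal_sub (x : ℝ) (z : ℂ) : z.im ≤ ‖(x : ℂ) - z‖ := by
  refine le_trans ?_ (Complex.abs_im_le_norm _)
  simp [le_abs_self]

lemma norm_cauchyTransform_le_div_im {g : ℝ → ℝ} (hg : Integrable g) {z : ℂ} (hz : 0 < z.im) :
    ‖cauchyTransform g z‖ ≤ (∫ x, |g x|) / z.im :=
  norm_cauchyTransform_le hg hz fun x _ => im_le_norm_ofReal_sub x z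

lemma norm_cauchyTransform_le_div_abs_re {g : ℝ → ℝ} (hg : Integrable g)
    (hs : ∀ x, x ∉ Ioo (-1 : ℝ) 1 → g x = 0) {z : ℂ} (hz : 1 < |z.re|) :
    ‖cauchyTransform g z‖ ≤ (∫ x, |g x|) / (|z.re| - 1) := by
  refine norm_cauchyTransform_le hg (by linarith) fun x hx => ?_
  have hx' : x ∈ Ioo (-1 : ℝ) 1 := by
    by_contra h
    exact hx (hs x h)
  refine le_trans ?_ (Complex.abs_re_le_norm _)
  have h1 : |x| ≤ 1 := abs_le.2 ⟨hx'.1.le, hx'.2.le⟩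
  have h2 := abs_sub_abs_le_abs_sub z.re x
  rw [abs_sub_comm] at h2
  simp only [Complex.sub_re, Complex.ofReal_re]
  linarith

lemma aestronglyMeasurable_cauchyKernel {g : ℝ → ℝ} (hg : Integrable g) (z : ℂ) (k : ℕ) :
    AEStronglyMeasurable fun x : ℝ => (g x : ℂ) * (((x : ℂ) - z)⁻¹) ^ k := by
  have h1 : AEStronglyMeasurable fun x : ℝ => (g x : ℂ) := hg.ofReal.aestronglyMeasurable
  exact h1.mul (by fun_prop : Measurable fun x : ℝ => (((x : ℂ) - z)⁻¹) ^ k).aestronglyMeasurable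

lemma differentiableAt_cauchyTransform {g : ℝ → ℝ} (hg : Integrable g) {z : ℂ} (hz : 0 < z.im) :
    DifferentiableAt ℂ (cauchyTransform g) z := by
  have hs : {y : ℂ | z.im / 2 < y.im} ∈ nhds z :=
    (isOpen_lt continuous_const Complex.continuous_im).mem_nhds (by simpa using hz)
  have key := hasDerivAt_integral_of_dominated_loc_of_deriv_le (𝕜 := ℂ) (μ := volume)
    (F := fun (y : ℂ) (x : ℝ) => (g x : ℂ) * ((x : ℂ) - y)⁻¹)
    (F' := fun (y : ℂ) (x : ℝ) => (g x : ℂ) * (((x : ℂ) - y)⁻¹) ^ 2)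
    (bound := fun x => |g x| * ((z.im / 2)⁻¹) ^ 2) hs ?_ ?_ ?_ ?_ ?_ ?_
  · exact key.2.differentiableAt
  · refine Eventually.of_forall fun y => ?_
    simpa using aestronglyMeasurable_cauchyKernel hg y 1
  · refine Integrable.mono' (hg.abs.mul_const (z.im)⁻¹)
      (by simpa using aestronglyMeasurable_cauchyKernel hg z 1) (Eventually.of_forall fun x => ?_)
    rw [norm_mul, norm_inv, Complex.norm_real, Real.norm_eq_abs]
    gcongr
    exact im_le_norm_ofReal_sub x z
  · exact aestronglyMeasurable_cauchyKernel hg z 2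
  · refine Eventually.of_forall fun x y hy => ?_
    rw [norm_mul, norm_pow, norm_inv, Complex.norm_real, Real.norm_eq_abs]
    gcongr
    exact (le_of_lt hy).trans (im_le_norm_ofReal_sub x y)
  · exact hg.abs.mul_const _
  · refine Eventually.of_forall fun x y hy => ?_
    have hne : (x : ℂ) - y ≠ 0 := by
      rw [← norm_pos_iff]
      have hy' : z.im / 2 < y.im := hy
      linarith [im_le_norm_ofReal_sub x y]
    have h1 : HasDerivAt (fun y : ℂ => (x : ℂ) - y) (-1) y := by
      simpa using (hasDerivAt_id y).const_sub (x : ℂ)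
    have h2 := (h1.inv hne).const_mul (g x : ℂ)
    rw [neg_neg, one_div, ← inv_pow] at h2
    exact h2

lemma integrable_cauchyTransform_pow {g : ℝ → ℝ} (hg : Integrable g)
    (hs : ∀ x, x ∉ Ioo (-1 : ℝ) 1 → g x = 0) {ε : ℝ} (hε : 0 < ε) {n : ℕ} (hn : 2 ≤ n) :
    Integrable fun t : ℝ => cauchyTransform g (t + ε * Complex.I) ^ n := by
  set N := ∫ x, |g x| with hN
  have hN0 : 0 ≤ N := integral_nonneg fun x => abs_nonneg _
  have hcont : Continuous fun t : ℝ => cauchyTransform g (t + ε * Complex.I) := by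
    refine continuous_iff_continuousAt.2 fun t => ?_
    have h := (differentiableAt_cauchyTransform hg (z := t + ε * Complex.I)
      (by simpa using hε)).continuousAt
    exact ContinuousAt.comp (f := fun t : ℝ => (t : ℂ) + ε * Complex.I) h (by fun_prop)
  set C := max (N / ε) N with hC
  have hb : ∀ t : ℝ, ‖cauchyTransform g (t + ε * Complex.I)‖ ≤ 3 * (C * (1 + |t|)⁻¹) := by
    intro t
    have hC0 : 0 ≤ C := hN0.trans (le_max_right _ _)
    rcases le_total |t| 2 with h | h
    · have h1 := norm_cauchyTransform_le_div_im hg (z := t + ε * Complex.I) (by simpa using hε)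
      have h1' : ‖cauchyTransform g (t + ε * Complex.I)‖ ≤ C := by
        refine h1.trans ?_
        simp [hC, hN]
      refine h1'.trans ?_
      rw [← mul_assoc, ← div_eq_mul_inv, le_div_iff₀ (by positivity)]
      nlinarith
    · have h1 := norm_cauchyTransform_le_div_abs_re hg hs (z := t + ε * Complex.I)
        (by simp; linarith)
      have h2 : ((t : ℂ) + ε * Complex.I).re = t := by simp
      rw [h2, ← hN] at h1
      refine h1.trans ?_
      rw [← mul_assoc, ← div_eq_mul_inv, div_le_div_iff₀ (by linarith) (by positivity)]
      have h3 : N ≤ C := le_max_right _ _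
      nlinarith
  have hint : Integrable fun t : ℝ => (3 * C) ^ n * (1 + t ^ 2)⁻¹ :=
    integrable_inv_one_add_sq.const_mul _
  refine hint.mono' (hcont.pow n).aestronglyMeasurable (Eventually.of_forall fun t => ?_)
  rw [norm_pow]
  have ht : 0 ≤ |t| := abs_nonneg t
  calc ‖cauchyTransform g (t + ε * Complex.I)‖ ^ n ≤ (3 * (C * (1 + |t|)⁻¹)) ^ n := by
        gcongr
        exact hb t
    _ = (3 * C) ^ n * ((1 + |t|)⁻¹) ^ n := by rw [← mul_assoc, mul_pow]
    _ ≤ (3 * C) ^ n * ((1 + |t|)⁻¹) ^ 2 := by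
        have hC0 : 0 ≤ C := hN0.trans (le_max_right _ _)
        gcongr ?_ * ?_
        exact pow_le_pow_of_le_one (by positivity) (inv_le_one_of_one_le₀ (by linarith)) hn
    _ ≤ (3 * C) ^ n * (1 + t ^ 2)⁻¹ := by
        have hC0 : 0 ≤ C := hN0.trans (le_max_right _ _)
        rw [inv_pow]
        gcongr
        nlinarith [sq_abs t]

/-- The Cauchy theorem for powers of the Cauchy transform on horizontal lines. -/
lemma integral_cauchyTransform_pow_eq_zero {g : ℝ → ℝ} (hg : Integrable g)
    (hs : ∀ x, x ∉ Ioo (-1 : ℝ) 1 → g x = 0) {ε : ℝ} (hε : 0 < ε) {n : ℕ} (hn : 2 ≤ n) :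
    ∫ t : ℝ, cauchyTransform g (t + ε * Complex.I) ^ n = 0 := by
  set N := ∫ x, |g x| with hN
  have hN0 : 0 ≤ N := integral_nonneg fun x => abs_nonneg _
  have hint := integrable_cauchyTransform_pow hg hs hε hn
  have hlim := intervalIntegral_tendsto_integral hint tendsto_neg_atTop_atBot tendsto_id
  refine tendsto_nhds_unique hlim ?_
  have hbound : ∀ᶠ R : ℝ in atTop,
      ‖∫ t in (-R)..(id R), cauchyTransform g (t + ε * Complex.I) ^ n‖ ≤ 16 * N ^ 2 * R⁻¹ := by
    filter_upwards [eventually_ge_atTop 2, eventually_ge_atTop (2 * N)] with R hR2 hRN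
    have hR0 : 0 < R := by linarith
    have hsmall : ∀ z : ℂ, ‖cauchyTransform g z‖ ≤ N / (R - 1) →
        ‖cauchyTransform g z ^ n‖ ≤ (2 * N / R) ^ 2 := by
      intro z hz
      have h1 : ‖cauchyTransform g z‖ ≤ 2 * N / R := by
        refine hz.trans ?_
        rw [div_le_div_iff₀ (by linarith) hR0]
        nlinarith
      rw [norm_pow]
      calc ‖cauchyTransform g z‖ ^ n ≤ (2 * N / R) ^ n := by gcongr
        _ ≤ (2 * N / R) ^ 2 :=
          pow_le_pow_of_le_one (by positivity) ((div_le_one hR0).2 hRN) hn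
    have hrect := Complex.integral_boundary_rect_eq_zero_of_differentiableOn
      (fun z => cauchyTransform g z ^ n) (⟨-R, ε⟩ : ℂ) (⟨R, ε + R⟩ : ℂ) ?_
    swap
    · intro z hz
      have hz2 : z.im ∈ uIcc ε (ε + R) := hz.2
      rw [uIcc_of_le (by linarith)] at hz2
      exact ((differentiableAt_cauchyTransform hg (hε.trans_le hz2.1)).pow n).differentiableWithinAt
    simp only at hrect
    have htop : ‖∫ x in (-R)..R, cauchyTransform g (x + (ε + R : ℝ) * Complex.I) ^ n‖
        ≤ (2 * N / R) ^ 2 * |R - (-R)| := by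
      refine intervalIntegral.norm_integral_le_of_norm_le_const fun x _ => hsmall _ ?_
      have him : ((x : ℂ) + (ε + R : ℝ) * Complex.I).im = ε + R := by simp
      refine (norm_cauchyTransform_le_div_im hg (by rw [him]; linarith)).trans ?_
      rw [him]
      gcongr ?_ / ?_ <;> linarith
    have hside : ∀ s : ℝ, |s| = R →
        ‖∫ y in ε..(ε + R), cauchyTransform g (s + y * Complex.I) ^ n‖
          ≤ (2 * N / R) ^ 2 * |ε + R - ε| := by
      intro s hsR
      refine intervalIntegral.norm_integral_le_of_norm_le_const fun y _ => hsmall _ ?_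
      have hre : ((s : ℂ) + y * Complex.I).re = s := by simp
      have := norm_cauchyTransform_le_div_abs_re hg hs (z := (s : ℂ) + y * Complex.I)
        (by rw [hre]; linarith)
      rwa [hre, hsR] at this
    have hr := hside R (abs_of_pos hR0)
    have hl := hside (-R) (by rw [abs_neg, abs_of_pos hR0])
    simp only [smul_eq_mul] at hrect
    rw [id]
    have heq : ∫ t in (-R)..R, cauchyTransform g (t + ε * Complex.I) ^ n
        = (∫ x in (-R)..R, cauchyTransform g (x + (ε + R : ℝ) * Complex.I) ^ n)
          - Complex.I * (∫ y in ε..(ε + R), cauchyTransform g (R + y * Complex.I) ^ n)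
          + Complex.I * ∫ y in ε..(ε + R), cauchyTransform g ((-R : ℝ) + y * Complex.I) ^ n := by
      linear_combination hrect
    rw [heq]
    refine (norm_add_le _ _).trans ((add_le_add_left (norm_sub_le _ _) _).trans ?_)
    rw [norm_mul, norm_mul, Complex.norm_I, one_mul, one_mul]
    have e1 : |R - (-R)| = 2 * R := by rw [abs_of_nonneg] <;> linarith
    have e2 : |ε + R - ε| = R := by rw [abs_of_nonneg] <;> linarith
    rw [e1] at htop
    rw [e2] at hr hl
    have e3 : 16 * N ^ 2 * R⁻¹ = (2 * N / R) ^ 2 * (2 * R) + (2 * N / R) ^ 2 * R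
        + (2 * N / R) ^ 2 * R := by
      field_simp
      ring
    linarith
  refine squeeze_zero_norm' hbound ?_
  have h0 := (tendsto_inv_atTop_zero (𝕜 := ℝ)).const_mul (16 * N ^ 2)
  rwa [mul_zero] at h0

/-- The kernel `1 / s`, truncated to `ε < |s|`. -/
noncomputable def truncKernel (ε s : ℝ) : ℝ := if ε < |s| then s⁻¹ else 0

lemma abs_truncKernel_le {ε : ℝ} (hε : 0 < ε) (s : ℝ) : |truncKernel ε s| ≤ ε⁻¹ := by
  unfold truncKernel
  split_ifs with h
  · rw [abs_inv]
    gcongr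
  · simpa using hε.le

lemma measurable_truncKernel (ε : ℝ) : Measurable (truncKernel ε) :=
  Measurable.ite (measurableSet_lt measurable_const (by fun_prop)) measurable_inv measurable_const

/-- The Hilbert transform, truncated at distance `ε` and without the factor `1 / π`. -/
noncomputable def truncHilbert {E : Type*} [NormedAddCommGroup E] [NormedSpace ℝ E]
    (g : ℝ → E) (ε t : ℝ) : E :=
  ∫ x, truncKernel ε (x - t) • g x

lemma integrable_truncKernel_smul {E : Type*} [NormedAddCommGroup E] [NormedSpace ℝ E]
    {g : ℝ → E} (hg : Integrable g) {ε : ℝ} (hε : 0 < ε) (t : ℝ) :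
    Integrable fun x => truncKernel ε (x - t) • g x := by
  refine Integrable.bdd_smul (C := ε⁻¹) hg ?_ (Eventually.of_forall fun x => ?_)
  · exact ((measurable_truncKernel ε).comp (by fun_prop)).aestronglyMeasurable
  · exact abs_truncKernel_le hε _

lemma abs_truncKernel_sub_le {ε : ℝ} (hε : 0 < ε) (s : ℝ) :
    |truncKernel ε s - s / (s ^ 2 + ε ^ 2)| ≤ ε / (s ^ 2 + ε ^ 2) := by
  have hpos : 0 < s ^ 2 + ε ^ 2 := by positivity
  unfold truncKernel
  split_ifs with h
  · have hs : s ≠ 0 := by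
      rintro rfl
      simp at h
      linarith
    have h1 : s⁻¹ - s / (s ^ 2 + ε ^ 2) = s⁻¹ * ε ^ 2 / (s ^ 2 + ε ^ 2) := by
      field_simp
      ring
    rw [h1, abs_div, abs_of_pos hpos, abs_mul, abs_inv, abs_of_nonneg (sq_nonneg ε)]
    gcongr
    rw [inv_mul_le_iff₀ (hε.trans h)]
    nlinarith
  · rw [zero_sub, abs_neg, abs_div, abs_of_pos hpos]
    gcongr
    exact not_lt.1 h

lemma re_inv_ofReal_sub (x t ε : ℝ) :
    (((x : ℂ) - (t + ε * Complex.I))⁻¹).re = (x - t) / ((x - t) ^ 2 + ε ^ 2) := by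
  rw [Complex.inv_re, Complex.normSq_apply]
  simp [sq]

lemma im_inv_ofReal_sub (x t ε : ℝ) :
    (((x : ℂ) - (t + ε * Complex.I))⁻¹).im = ε / ((x - t) ^ 2 + ε ^ 2) := by
  rw [Complex.inv_im, Complex.normSq_apply]
  simp [sq]

lemma integrable_cauchyKernel {g : ℝ → ℝ} (hg : Integrable g) {z : ℂ} (hz : 0 < z.im) :
    Integrable fun x : ℝ => (g x : ℂ) * ((x : ℂ) - z)⁻¹ := by
  refine Integrable.mono' (hg.abs.mul_const (z.im)⁻¹)
    (by simpa using aestronglyMeasurable_cauchyKernel hg z 1) (Eventually.of_forall fun x => ?_)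
  rw [norm_mul, norm_inv, Complex.norm_real, Real.norm_eq_abs]
  gcongr
  exact im_le_norm_ofReal_sub x z

lemma add_pow_le_two_pow_mul (a b : ENNReal) (n : ℕ) :
    (a + b) ^ n ≤ 2 ^ n * (a ^ n + b ^ n) := by
  wlog h : a ≤ b generalizing a b
  · rw [add_comm a, add_comm (a ^ n)]
    exact this b a (le_of_not_ge h)
  calc (a + b) ^ n ≤ (b + b) ^ n := by gcongr
    _ = 2 ^ n * b ^ n := by rw [← two_mul, mul_pow]
    _ ≤ _ := by
      gcongr
      exact le_add_self

open ProbabilityTheory in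
lemma ofReal_poisson_le {ε : NNReal} (x t : ℝ) :
    ENNReal.ofReal (ε / ((x - t) ^ 2 + ε ^ 2)) ≤ 4 * cauchyPDF t ε x := by
  have h4 : (4 : ENNReal) = ENNReal.ofReal 4 := by simp
  rw [cauchyPDF_def, cauchyPDFReal_def, h4, ← ENNReal.ofReal_mul (by norm_num)]
  refine ENNReal.ofReal_le_ofReal ?_
  have hπ : 1 ≤ 4 * Real.pi⁻¹ := by
    rw [← div_eq_mul_inv, one_le_div Real.pi_pos]
    exact Real.pi_le_four
  calc (ε : ℝ) / ((x - t) ^ 2 + ε ^ 2) = 1 * (ε * ((x - t) ^ 2 + (ε : ℝ) ^ 2)⁻¹) := by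
        rw [one_mul, div_eq_mul_inv]
    _ ≤ (4 * Real.pi⁻¹) * (ε * ((x - t) ^ 2 + (ε : ℝ) ^ 2)⁻¹) := by gcongr
    _ = _ := by ring

open ProbabilityTheory in
lemma enorm_integral_le_poisson {g φ : ℝ → ℝ} {ε : NNReal} {t : ℝ}
    (h : ∀ x, |φ x| ≤ ε / ((x - t) ^ 2 + ε ^ 2)) :
    ‖∫ x, φ x * g x‖ₑ ≤ 4 * ∫⁻ x, cauchyPDF t ε x * ‖g x‖ₑ := by
  refine (enorm_integral_le_lintegral_enorm _).trans ?_
  rw [← lintegral_const_mul' _ _ (by simp)]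
  refine lintegral_mono fun x => ?_
  rw [enorm_mul, ← mul_assoc]
  gcongr
  rw [← ofReal_norm]
  exact (ENNReal.ofReal_le_ofReal (h x)).trans (ofReal_poisson_le x t)

open ProbabilityTheory in
lemma enorm_im_cauchyTransform_le {g : ℝ → ℝ} (hg : Integrable g) {ε : NNReal} (hε : 0 < ε)
    (t : ℝ) : ‖(cauchyTransform g (t + (ε : ℝ) * Complex.I)).im‖ₑ
      ≤ 4 * ∫⁻ x, cauchyPDF t ε x * ‖g x‖ₑ := by
  have hi := integrable_cauchyKernel hg (z := t + (ε : ℝ) * Complex.I) (by simpa using hε)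
  have h1 : (cauchyTransform g (t + (ε : ℝ) * Complex.I)).im
      = ∫ x, ((ε : ℝ) / ((x - t) ^ 2 + (ε : ℝ) ^ 2)) * g x := by
    rw [cauchyTransform, ← Complex.imCLM_apply, ← Complex.imCLM.integral_comp_comm hi]
    refine integral_congr_ae (Eventually.of_forall fun x => ?_)
    simp only [Complex.imCLM_apply, Complex.im_ofReal_mul, im_inv_ofReal_sub]
    ring
  rw [h1]
  refine enorm_integral_le_poisson fun x => ?_
  rw [abs_of_nonneg (by positivity)]

open ProbabilityTheory in
lemma enorm_truncHilbert_sub_re_le {g : ℝ → ℝ} (hg : Integrable g) {ε : NNReal} (hε : 0 < ε)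
    (t : ℝ) : ‖truncHilbert g ε t - (cauchyTransform g (t + (ε : ℝ) * Complex.I)).re‖ₑ
      ≤ 4 * ∫⁻ x, cauchyPDF t ε x * ‖g x‖ₑ := by
  have hi := integrable_cauchyKernel hg (z := t + (ε : ℝ) * Complex.I) (by simpa using hε)
  have h1 : truncHilbert g ε t - (cauchyTransform g (t + (ε : ℝ) * Complex.I)).re
      = ∫ x, (truncKernel ε (x - t) - (x - t) / ((x - t) ^ 2 + (ε : ℝ) ^ 2)) * g x := by
    rw [cauchyTransform, ← Complex.reCLM_apply, ← Complex.reCLM.integral_comp_comm hi,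
      truncHilbert, ← integral_sub (integrable_truncKernel_smul hg (by exact_mod_cast hε) t)
        (Complex.reCLM.integrable_comp hi)]
    refine integral_congr_ae (Eventually.of_forall fun x => ?_)
    simp only [Complex.reCLM_apply, Complex.re_ofReal_mul, re_inv_ofReal_sub, smul_eq_mul]
    ring
  rw [h1]
  exact enorm_integral_le_poisson fun x => abs_truncKernel_sub_le (by exact_mod_cast hε) _

lemma lintegral_re_cauchyTransform_pow_le {g : ℝ → ℝ} (hg : Integrable g)
    (hs : ∀ x, x ∉ Ioo (-1 : ℝ) 1 → g x = 0) {ε : ℝ} (hε : 0 < ε) {n : ℕ} (hn : 2 ≤ n)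
    (he : Even n) :
    ∫⁻ t : ℝ, ‖(cauchyTransform g (t + ε * Complex.I)).re‖ₑ ^ n
      ≤ 3 * (4 * n) ^ n * ∫⁻ t : ℝ, ‖(cauchyTransform g (t + ε * Complex.I)).im‖ₑ ^ n := by
  set F : ℝ → ℂ := fun t => cauchyTransform g (t + ε * Complex.I) with hF
  have hint : Integrable fun t => F t ^ n := integrable_cauchyTransform_pow hg hs hε hn
  have hcont : Continuous F := by
    refine continuous_iff_continuousAt.2 fun t => ?_
    have h := (differentiableAt_cauchyTransform hg (z := t + ε * Complex.I)
      (by simpa using hε)).continuousAt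
    exact ContinuousAt.comp (f := fun t : ℝ => (t : ℂ) + ε * Complex.I) h (by fun_prop)
  have hre : Integrable fun t => (F t).re ^ n := by
    refine hint.norm.mono' ((Complex.continuous_re.comp hcont).pow n).aestronglyMeasurable
      (Eventually.of_forall fun t => ?_)
    rw [norm_pow, norm_pow]
    gcongr
    exact Complex.abs_re_le_norm _
  have him : Integrable fun t => |(F t).im| ^ n := by
    refine hint.norm.mono' ((Complex.continuous_im.comp hcont).abs.pow n).aestronglyMeasurable
      (Eventually.of_forall fun t => ?_)
    rw [norm_pow, norm_pow, Real.norm_eq_abs, abs_abs]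
    gcongr
    exact Complex.abs_im_le_norm _
  have hre2 : Integrable fun t => (F t ^ n).re := hint.re
  have hz : ∫ t, (F t ^ n).re = 0 := by
    have h := Complex.reCLM.integral_comp_comm hint
    simp only [Complex.reCLM_apply] at h
    rw [h, integral_cauchyTransform_pow_eq_zero hg hs hε hn, Complex.zero_re]
  have hle : ∫ t, (F t).re ^ n ≤ 3 * (4 * n) ^ n * ∫ t, |(F t).im| ^ n := by
    calc ∫ t, (F t).re ^ n
        ≤ ∫ t, (2 * (F t ^ n).re + 3 * (4 * n) ^ n * |(F t).im| ^ n) :=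
          integral_mono hre ((hre2.const_mul 2).add (him.const_mul _))
            fun t => re_pow_le_of_even he (by omega) (F t)
      _ = _ := by
        rw [integral_add (hre2.const_mul 2) (him.const_mul _), integral_const_mul,
          integral_const_mul, hz, mul_zero, zero_add]
  have e1 : ∫⁻ t, ‖(F t).re‖ₑ ^ n = ENNReal.ofReal (∫ t, (F t).re ^ n) := by
    rw [ofReal_integral_eq_lintegral_ofReal hre (Eventually.of_forall fun t => he.pow_nonneg _)]
    refine lintegral_congr fun t => ?_
    rw [← he.pow_abs, ENNReal.ofReal_pow (abs_nonneg _), Real.enorm_eq_ofReal_abs]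
  have e2 : ∫⁻ t, ‖(F t).im‖ₑ ^ n = ENNReal.ofReal (∫ t, |(F t).im| ^ n) := by
    rw [ofReal_integral_eq_lintegral_ofReal him (Eventually.of_forall fun t => by positivity)]
    refine lintegral_congr fun t => ?_
    rw [ENNReal.ofReal_pow (abs_nonneg _), Real.enorm_eq_ofReal_abs]
  rw [e1, e2]
  refine (ENNReal.ofReal_le_ofReal hle).trans_eq ?_
  rw [ENNReal.ofReal_mul (by positivity), ENNReal.ofReal_mul (by norm_num),
    ENNReal.ofReal_pow (by positivity), ENNReal.ofReal_mul (by norm_num)]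
  simp

open ProbabilityTheory in
lemma lintegral_truncHilbert_real_pow_le {g : ℝ → ℝ} (hm : Measurable g) (hg : Integrable g)
    (hs : ∀ x, x ∉ Ioo (-1 : ℝ) 1 → g x = 0) {ε : ℝ} (hε : 0 < ε) {n : ℕ} (hn : 2 ≤ n)
    (he : Even n) :
    ∫⁻ t, ‖truncHilbert g ε t‖ₑ ^ n ≤ (64 * n) ^ n * ∫⁻ x, ‖g x‖ₑ ^ n := by
  lift ε to NNReal using hε.le
  have hε' : 0 < ε := by exact_mod_cast hε
  set G := ∫⁻ x, ‖g x‖ₑ ^ n with hG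
  set A : ℝ → ENNReal := fun t => ∫⁻ x, cauchyPDF t ε x * ‖g x‖ₑ with hA
  have hAm : Measurable A := by
    have h1 : Measurable (fun p : ℝ × ℝ => cauchyPDF p.1 ε p.2 * ‖g p.2‖ₑ) := by
      unfold cauchyPDF cauchyPDFReal
      fun_prop
    exact h1.lintegral_prod_right'
  have hAle : ∫⁻ t, (4 * A t) ^ n ≤ 4 ^ n * G := by
    simp_rw [mul_pow]
    rw [lintegral_const_mul _ (hAm.pow_const n)]
    gcongr
    exact lintegral_poisson_pow_le hε'.ne' hm.enorm (by omega)
  have him : ∫⁻ t : ℝ, ‖(cauchyTransform g (t + (ε : ℝ) * Complex.I)).im‖ₑ ^ n ≤ 4 ^ n * G := by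
    refine le_trans (lintegral_mono fun t => ?_) hAle
    gcongr
    exact enorm_im_cauchyTransform_le hg hε' t
  have hre := lintegral_re_cauchyTransform_pow_le hg hs hε hn he
  have hpt : ∀ t : ℝ, ‖truncHilbert g ε t‖ₑ ^ n
      ≤ 2 ^ n * ((4 * A t) ^ n + ‖(cauchyTransform g (t + (ε : ℝ) * Complex.I)).re‖ₑ ^ n) := by
    intro t
    refine le_trans ?_ (add_pow_le_two_pow_mul _ _ n)
    gcongr
    refine le_trans ?_ (add_le_add_left (enorm_truncHilbert_sub_re_le hg hε' t) _)
    refine le_trans (le_of_eq ?_) (enorm_add_le _ _)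
    rw [sub_add_cancel]
  have hn1 : (1 : ENNReal) ≤ (4 * n) ^ n := by
    refine one_le_pow₀ ?_
    exact_mod_cast (by omega : 1 ≤ 4 * n)
  have h4 : (4 : ENNReal) ≤ 2 ^ n := by
    calc (4 : ENNReal) = 2 ^ 2 := by norm_num
      _ ≤ 2 ^ n := pow_le_pow_right₀ (by norm_num) hn
  calc ∫⁻ t, ‖truncHilbert g ε t‖ₑ ^ n
      ≤ ∫⁻ t : ℝ, 2 ^ n * ((4 * A t) ^ n
          + ‖(cauchyTransform g (t + (ε : ℝ) * Complex.I)).re‖ₑ ^ n) := lintegral_mono hpt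
    _ = 2 ^ n * ((∫⁻ t, (4 * A t) ^ n)
          + ∫⁻ t : ℝ, ‖(cauchyTransform g (t + (ε : ℝ) * Complex.I)).re‖ₑ ^ n) := by
        rw [lintegral_const_mul' _ _ (by simp), lintegral_add_left (by fun_prop)]
    _ ≤ 2 ^ n * (1 * (4 ^ n * G) + 3 * (4 * n) ^ n * (4 ^ n * G)) := by
        rw [one_mul]
        gcongr
        exact hre.trans (by gcongr)
    _ ≤ 2 ^ n * ((4 * n) ^ n * (4 ^ n * G) + 3 * (4 * n) ^ n * (4 ^ n * G)) := by gcongr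
    _ = 2 ^ n * 4 ^ n * (4 * n) ^ n * 4 * G := by ring
    _ ≤ 2 ^ n * 4 ^ n * (4 * n) ^ n * 2 ^ n * G := by gcongr
    _ = (64 * n) ^ n * G := by
        rw [← mul_pow, ← mul_pow, ← mul_pow]
        congr 2
        ring

lemma measurable_truncHilbert {g : ℝ → ℂ} (hm : Measurable g) (ε : ℝ) :
    Measurable (truncHilbert g ε) := by
  refine StronglyMeasurable.measurable (StronglyMeasurable.integral_prod_right (f := fun t x =>
    truncKernel ε (x - t) • g x) (Measurable.stronglyMeasurable ?_))
  exact ((measurable_truncKernel ε).comp (by fun_prop)).smul (hm.comp measurable_snd)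

/-- Truncated Hilbert transforms are bounded on `L^n`, with a constant linear in `n`. -/
lemma lintegral_truncHilbert_pow_le {g : ℝ → ℂ} (hm : Measurable g) (hg : Integrable g)
    (hs : ∀ x, x ∉ Ioo (-1 : ℝ) 1 → g x = 0) {ε : ℝ} (hε : 0 < ε) {n : ℕ} (hn : 2 ≤ n)
    (he : Even n) :
    ∫⁻ t, ‖truncHilbert g ε t‖ₑ ^ n ≤ (256 * n) ^ n * ∫⁻ x, ‖g x‖ₑ ^ n := by
  set G := ∫⁻ x, ‖g x‖ₑ ^ n with hG
  have hi := integrable_truncKernel_smul hg hε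
  have key : ∀ (T : ℂ →L[ℝ] ℝ), (∀ z, ‖T z‖ ≤ ‖z‖) →
      ∫⁻ t, ‖T (truncHilbert g ε t)‖ₑ ^ n ≤ (64 * n) ^ n * G := by
    intro T hT
    have h1 := lintegral_truncHilbert_real_pow_le (g := fun x => T (g x))
      (T.continuous.measurable.comp hm) (T.integrable_comp hg)
      (fun x hx => by simp [hs x hx]) hε hn he
    have h2 : ∀ t, T (truncHilbert g ε t) = truncHilbert (fun x => T (g x)) ε t := by
      intro t
      rw [truncHilbert, truncHilbert, ← T.integral_comp_comm (hi t)]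
      simp only [map_smul]
    simp_rw [h2]
    refine h1.trans ?_
    refine mul_le_mul_right (lintegral_mono fun x => ?_) _
    gcongr
    exact enorm_le_iff_norm_le.2 (hT _)
  have hre := key Complex.reCLM fun z => Complex.abs_re_le_norm z
  have him := key Complex.imCLM fun z => Complex.abs_im_le_norm z
  have hmeas := measurable_truncHilbert hm ε
  have hpt : ∀ t, ‖truncHilbert g ε t‖ₑ ^ n ≤ 2 ^ n * (‖Complex.reCLM (truncHilbert g ε t)‖ₑ ^ n
      + ‖Complex.imCLM (truncHilbert g ε t)‖ₑ ^ n) := by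
    intro t
    refine le_trans ?_ (add_pow_le_two_pow_mul _ _ n)
    gcongr
    rw [← ofReal_norm, ← ofReal_norm, ← ofReal_norm, ← ENNReal.ofReal_add (by positivity)
      (by positivity)]
    exact ENNReal.ofReal_le_ofReal (Complex.norm_le_abs_re_add_abs_im _)
  calc ∫⁻ t, ‖truncHilbert g ε t‖ₑ ^ n
      ≤ ∫⁻ t, 2 ^ n * (‖Complex.reCLM (truncHilbert g ε t)‖ₑ ^ n
        + ‖Complex.imCLM (truncHilbert g ε t)‖ₑ ^ n) := lintegral_mono hpt
    _ = 2 ^ n * ((∫⁻ t, ‖Complex.reCLM (truncHilbert g ε t)‖ₑ ^ n)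
        + ∫⁻ t, ‖Complex.imCLM (truncHilbert g ε t)‖ₑ ^ n) := by
        rw [lintegral_const_mul' _ _ (by simp), lintegral_add_left (by fun_prop)]
    _ ≤ 2 ^ n * ((64 * n) ^ n * G + (64 * n) ^ n * G) := by gcongr
    _ = 2 ^ n * 2 * (64 * n) ^ n * G := by ring
    _ ≤ 2 ^ n * 2 ^ n * (64 * n) ^ n * G := by
        gcongr
        exact le_self_pow₀ (by norm_num) (by omega)
    _ = (256 * n) ^ n * G := by
        rw [← mul_pow, ← mul_pow]
        congr 2
        ring

lemma continuousAt_truncHilbert {g : ℝ → ℂ} (hg : Integrable g) {ε : ℝ} (hε : 0 < ε) (t : ℝ) :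
    ContinuousAt (fun δ => truncHilbert g δ t) ε := by
  refine continuousAt_of_dominated (bound := fun x => (ε / 2)⁻¹ * ‖g x‖) ?_ ?_
    (hg.norm.const_mul _) ?_
  · filter_upwards [lt_mem_nhds hε] with δ hδ
    exact (integrable_truncKernel_smul hg hδ t).aestronglyMeasurable
  · filter_upwards [lt_mem_nhds (half_lt_self hε)] with δ hδ
    have hδ0 : 0 < δ := (half_pos hε).trans hδ
    refine Eventually.of_forall fun x => ?_
    rw [norm_smul, Real.norm_eq_abs]
    gcongr
    refine (abs_truncKernel_le hδ0 _).trans ?_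
    gcongr
  · have hnull : volume ({t - ε, t + ε} : Set ℝ) = 0 := (Set.toFinite _).measure_zero _
    filter_upwards [measure_eq_zero_iff_ae_notMem.1 hnull] with x hx
    have hne : ε ≠ |x - t| := by
      intro h
      apply hx
      rcases abs_choice (x - t) with h' | h' <;> rw [h'] at h
      · right
        simp only [mem_singleton_iff]
        linarith
      · left
        linarith
    have hc : ContinuousAt (fun δ => truncKernel δ (x - t)) ε := by
      rcases lt_or_gt_of_ne hne with h | h
      · refine (continuousAt_const (y := (x - t)⁻¹)).congr ?_
        filter_upwards [gt_mem_nhds h] with δ hδ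
        simp [truncKernel, hδ]
      · refine (continuousAt_const (y := (0 : ℝ))).congr ?_
        filter_upwards [lt_mem_nhds h] with δ hδ
        simp [truncKernel, not_lt.2 hδ.le]
    exact hc.smul continuousAt_const

/-- For functions continuous on `(0, ∞)`, the right limit at `0` may be taken along rationals. -/
lemma tendsto_nhdsGT_zero_iff_rat {h : ℝ → ℂ} (hc : ∀ ε > 0, ContinuousAt h ε) (L : ℂ) :
    Tendsto h (nhdsWithin 0 (Ioi 0)) (nhds L) ↔
      Tendsto (fun q : ℚ => h q) (comap ((↑) : ℚ → ℝ) (nhdsWithin 0 (Ioi 0))) (nhds L) := by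
  refine ⟨fun H => H.comp tendsto_comap, fun H => ?_⟩
  rw [Metric.tendsto_nhds] at H ⊢
  intro r hr
  have h1 := H (r / 2) (half_pos hr)
  rw [eventually_comap] at h1
  obtain ⟨η, hη, h2⟩ := mem_nhdsGT_iff_exists_Ioo_subset.1 h1
  filter_upwards [Ioo_mem_nhdsGT hη] with ε hε
  have hcl : ε ∈ closure (Ioo 0 η ∩ range ((↑) : ℚ → ℝ)) :=
    Rat.denseRange_cast.open_subset_closure_inter isOpen_Ioo hε
  have hmem := mem_closure_image (hc ε hε.1) hcl
  have hsub : h '' (Ioo 0 η ∩ range ((↑) : ℚ → ℝ)) ⊆ Metric.closedBall L (r / 2) := by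
    rintro _ ⟨_, ⟨hx, q, rfl⟩, rfl⟩
    exact (h2 hx q rfl).le
  have := closure_minimal hsub Metric.isClosed_closedBall hmem
  exact lt_of_le_of_lt this (half_lt_self hr)

lemma lim_eq_of_not_exists {F : Filter ℂ} (h : ¬ ∃ x, F ≤ nhds x) :
    lim F = Classical.epsilon fun _ : ℂ => False := by
  have : (fun x => F ≤ nhds x) = fun _ => False := by
    funext x
    exact eq_false fun hx => h ⟨x, hx⟩
  rw [lim, this]

lemma measurableSet_exists_tendsto_truncHilbert {g : ℝ → ℂ} (hm : Measurable g)
    (hg : Integrable g) :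
    MeasurableSet {t | ∃ L, Tendsto (fun ε => (Real.pi : ℂ)⁻¹ * truncHilbert g ε t)
      (nhdsWithin 0 (Ioi 0)) (nhds L)} := by
  have h1 : ∀ t L, Tendsto (fun ε => (Real.pi : ℂ)⁻¹ * truncHilbert g ε t)
      (nhdsWithin 0 (Ioi 0)) (nhds L) ↔
      Tendsto (fun q : ℚ => (Real.pi : ℂ)⁻¹ * truncHilbert g q t)
        (comap ((↑) : ℚ → ℝ) (nhdsWithin 0 (Ioi 0))) (nhds L) := fun t L =>
    tendsto_nhdsGT_zero_iff_rat
      (fun ε hε => continuousAt_const.mul (continuousAt_truncHilbert hg hε t)) L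
  simp_rw [h1]
  exact MeasureTheory.measurableSet_exists_tendsto fun q =>
    (measurable_truncHilbert hm q).const_mul _

/-- On `(-1, 1)`, `FHT f` is the limit of the truncated Hilbert transforms. -/
lemma FHT_eq_limUnder_truncHilbert {f g : ℝ → ℂ} (hg : Integrable g)
    (hs : ∀ x, x ∉ Ioo (-1 : ℝ) 1 → g x = 0)
    (hfg : ∀ᵐ x, x ∈ Ioo (-1 : ℝ) 1 → g x = f x) {t : ℝ} (ht : t ∈ Ioo (-1 : ℝ) 1) :
    FHT f t = limUnder (nhdsWithin (0 : ℝ) (Ioi 0))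
      fun ε => (Real.pi : ℂ)⁻¹ * truncHilbert g ε t := by
  unfold FHT limUnder
  congr 1
  refine Filter.map_congr ?_
  filter_upwards [self_mem_nhdsWithin] with ε hε
  have hε0 : 0 < ε := hε
  congr 1
  set K : ℝ → ℂ := fun x => truncKernel ε (x - t) • g x with hK
  have hKi : Integrable K := integrable_truncKernel_smul hg hε0 t
  have hsplit : K = fun x => (Ioo (-1) (t - ε)).indicator K x + (Ioo (t + ε) 1).indicator K x := by
    funext x
    by_cases hA : x ∈ Ioo (-1) (t - ε)
    · have hB : x ∉ Ioo (t + ε) 1 := fun hB => by linarith [hA.2, hB.1]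
      simp [hA, hB]
    · by_cases hB : x ∈ Ioo (t + ε) 1
      · simp [hA, hB]
      · rw [indicator_of_notMem hA, indicator_of_notMem hB, add_zero]
        simp only [hK]
        by_cases hx : x ∈ Ioo (-1 : ℝ) 1
        · have hle : ¬ ε < |x - t| := by
            rw [not_lt, abs_le]
            simp only [mem_Ioo, not_and, not_lt] at hA hB
            constructor
            · linarith [hA hx.1]
            · by_contra hcon
              linarith [hB (by linarith), hx.2]
          simp [truncKernel, hle]
        · simp [hs x hx]
  have hval : ∀ x, ε < |x - t| → g x = f x → K x = f x / ((x : ℂ) - t) := by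
    intro x h1 h2
    simp only [hK, truncKernel, h1, if_true, h2, Complex.real_smul]
    push_cast
    rw [div_eq_mul_inv, mul_comm]
  have hA : ∫ x in Ioo (-1) (t - ε), f x / ((x : ℂ) - t) = ∫ x in Ioo (-1) (t - ε), K x := by
    refine setIntegral_congr_ae measurableSet_Ioo ?_
    filter_upwards [hfg] with x hx hxA
    refine (hval x ?_ (hx ⟨hxA.1, by linarith [hxA.2, ht.2]⟩)).symm
    rw [lt_abs]
    right
    linarith [hxA.2]
  have hB : ∫ x in Ioo (t + ε) 1, f x / ((x : ℂ) - t) = ∫ x in Ioo (t + ε) 1, K x := by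
    refine setIntegral_congr_ae measurableSet_Ioo ?_
    filter_upwards [hfg] with x hx hxB
    refine (hval x ?_ (hx ⟨by linarith [hxB.1, ht.1], hxB.2⟩)).symm
    rw [lt_abs]
    left
    linarith [hxB.1]
  have htr : truncHilbert g ε t = ∫ x, K x := rfl
  rw [hA, hB, htr, ← integral_indicator measurableSet_Ioo, ← integral_indicator measurableSet_Ioo,
    ← integral_add (hKi.indicator measurableSet_Ioo) (hKi.indicator measurableSet_Ioo), ← hsplit]

/-- Exponential integrability controls moments. -/
lemma pow_le_mul_exp_rpow {α l y : ℝ} (hα : 0 < α) (hl : 0 < l) (hy : 0 ≤ y) {n : ℕ}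
    (hn : 0 < n) :
    y ^ n ≤ ((α / l) ^ α * (n : ℝ) ^ α) ^ n * Real.exp (l * y ^ (1 / α)) := by
  have hn0 : (0 : ℝ) < n := by exact_mod_cast hn
  set s := y ^ (1 / α) with hs
  have hs0 : 0 ≤ s := by positivity
  have hys : y = s ^ α := by
    rw [hs, ← Real.rpow_mul hy, one_div_mul_cancel hα.ne', Real.rpow_one]
  have h1 : s ≤ (α / l * n) * Real.exp (l * s / (α * n)) := by
    have h := Real.add_one_le_exp (l * s / (α * n))
    calc s = (α / l * n) * (l * s / (α * n)) := by field_simp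
      _ ≤ _ := by
        gcongr
        linarith
  have h2 : y ≤ ((α / l) ^ α * (n : ℝ) ^ α) * Real.exp (l * s / n) := by
    calc y = s ^ α := hys
      _ ≤ ((α / l * n) * Real.exp (l * s / (α * n))) ^ α := by gcongr
      _ = _ := by
        rw [Real.mul_rpow (by positivity) (by positivity),
          Real.mul_rpow (by positivity) (by positivity), ← Real.exp_mul]
        congr 2
        field_simp
  calc y ^ n ≤ (((α / l) ^ α * (n : ℝ) ^ α) * Real.exp (l * s / n)) ^ n := by gcongr
    _ = _ := by
      rw [mul_pow, ← Real.exp_nat_mul]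
      congr 2
      field_simp

lemma lintegral_pow_le_of_exp {Ω : Type*} [MeasurableSpace Ω] {μ : Measure Ω} {f : Ω → ℂ}
    {α l : ℝ} (hα : 0 < α) (hl : 0 < l) {n : ℕ} (hn : 0 < n) :
    ∫⁻ x, ‖f x‖ₑ ^ n ∂μ ≤ ENNReal.ofReal (((α / l) ^ α * (n : ℝ) ^ α) ^ n) *
      ∫⁻ x, ENNReal.ofReal (Real.exp (l * ‖f x‖ ^ (1 / α))) ∂μ := by
  rw [← lintegral_const_mul' _ _ (by simp)]
  refine lintegral_mono fun x => ?_
  rw [← ENNReal.ofReal_mul (by positivity), ← ofReal_norm, ← ENNReal.ofReal_pow (norm_nonneg _)]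
  exact ENNReal.ofReal_le_ofReal (pow_le_mul_exp_rpow hα hl (norm_nonneg _) hn)

lemma exp_le_of_forall_even_pow {β C y : ℝ} (hβ : 0 < β) (hC : 0 < C) (hy : 0 ≤ y) :
    ENNReal.ofReal (Real.exp (β / ((2 * C) ^ (1 / β) * Real.exp 1) * y ^ (1 / β)))
      ≤ ENNReal.ofReal (Real.exp (2 * β)) * (1 + ∑' k : ℕ, ENNReal.ofReal
        ((2 * C * ((2 * (k + 1) : ℕ) : ℝ) ^ β)⁻¹ ^ (2 * (k + 1)) * y ^ (2 * (k + 1)))) := by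
  set K := (2 * C) ^ (1 / β) with hK
  have hK0 : 0 < K := by positivity
  have hKβ : K ^ β = 2 * C := by
    rw [hK, ← Real.rpow_mul (by positivity), one_div_mul_cancel hβ.ne', Real.rpow_one]
  set s := y ^ (1 / β) with hs
  have hs0 : 0 ≤ s := by positivity
  have hys : y = s ^ β := by
    rw [hs, ← Real.rpow_mul hy, one_div_mul_cancel hβ.ne', Real.rpow_one]
  set D := K * Real.exp 1 with hD
  have hD0 : 0 < D := by positivity
  rcases lt_or_ge s (2 * D) with h | h
  · calc ENNReal.ofReal (Real.exp (β / D * s)) ≤ ENNReal.ofReal (Real.exp (2 * β)) * 1 := by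
          rw [mul_one]
          refine ENNReal.ofReal_le_ofReal (Real.exp_le_exp.2 ?_)
          rw [div_mul_eq_mul_div, div_le_iff₀ hD0]
          nlinarith
      _ ≤ _ := by
          gcongr
          exact le_self_add
  · obtain ⟨k, hk⟩ : ∃ k : ℕ, ⌊s / (2 * D)⌋₊ = k + 1 := by
      refine Nat.exists_eq_succ_of_ne_zero (Nat.pos_iff_ne_zero.1 (Nat.floor_pos.2 ?_))
      rwa [one_le_div (by positivity)]
    have hlow : ((k : ℝ) + 1) * (2 * D) ≤ s := by
      have := Nat.floor_le (a := s / (2 * D)) (by positivity)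
      rw [hk, le_div_iff₀ (by positivity)] at this
      exact_mod_cast this
    have hup : s ≤ ((k : ℝ) + 2) * (2 * D) := by
      have := Nat.lt_floor_add_one (s / (2 * D))
      rw [hk, div_lt_iff₀ (by positivity)] at this
      push_cast at this
      linarith
    set n := 2 * (k + 1) with hn
    have hncast : (n : ℝ) = 2 * ((k : ℝ) + 1) := by rw [hn]; push_cast; ring
    have hn0 : (0 : ℝ) < n := by rw [hncast]; positivity
    have hterm : Real.exp (β / D * s) ≤ Real.exp (2 * β) *
        ((2 * C * (n : ℝ) ^ β)⁻¹ ^ n * y ^ n) := by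
      have h1 : Real.exp β ≤ (2 * C * (n : ℝ) ^ β)⁻¹ * y := by
        rw [le_inv_mul_iff₀ (by positivity), ← hKβ, ← Real.mul_rpow hK0.le hn0.le,
          ← one_mul β, Real.exp_mul, one_mul,
          ← Real.mul_rpow (by positivity) (Real.exp_pos 1).le, hys]
        refine Real.rpow_le_rpow (by positivity) ?_ hβ.le
        rw [hncast]
        linarith
      calc Real.exp (β / D * s) ≤ Real.exp (2 * β + n * β) := by
            refine Real.exp_le_exp.2 ?_
            rw [div_mul_eq_mul_div, div_le_iff₀ hD0, hncast]
            nlinarith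
        _ = Real.exp (2 * β) * Real.exp β ^ n := by rw [Real.exp_add, Real.exp_nat_mul]
        _ ≤ Real.exp (2 * β) * ((2 * C * (n : ℝ) ^ β)⁻¹ * y) ^ n := by gcongr
        _ = _ := by rw [mul_pow]
    refine (ENNReal.ofReal_le_ofReal hterm).trans ?_
    rw [ENNReal.ofReal_mul (by positivity)]
    gcongr
    exact (ENNReal.le_tsum (f := fun k : ℕ => ENNReal.ofReal
        ((2 * C * ((2 * (k + 1) : ℕ) : ℝ) ^ β)⁻¹ ^ (2 * (k + 1)) * y ^ (2 * (k + 1)))) k).trans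
      le_add_self

/-- Moments of order `n` growing like `(C n ^ β) ^ n` give exponential integrability. -/
lemma exists_lintegral_exp_lt_top {Ω : Type*} [MeasurableSpace Ω] {μ : Measure Ω}
    [IsFiniteMeasure μ] {h : Ω → ℂ} (hh : AEStronglyMeasurable h μ) {β C : ℝ} (hβ : 0 < β)
    (hC : 0 < C) {M : ENNReal} (hM : M < ⊤)
    (hmom : ∀ n : ℕ, 2 ≤ n → Even n →
      ∫⁻ x, ‖h x‖ₑ ^ n ∂μ ≤ ENNReal.ofReal ((C * (n : ℝ) ^ β) ^ n) * M) :
    ∃ l > (0 : ℝ), ∫⁻ x, ENNReal.ofReal (Real.exp (l * ‖h x‖ ^ (1 / β))) ∂μ < ⊤ := by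
  refine ⟨β / ((2 * C) ^ (1 / β) * Real.exp 1), by positivity, ?_⟩
  have hterm : ∀ k : ℕ, ∫⁻ x, ENNReal.ofReal ((2 * C * ((2 * (k + 1) : ℕ) : ℝ) ^ β)⁻¹
      ^ (2 * (k + 1)) * ‖h x‖ ^ (2 * (k + 1))) ∂μ ≤ ENNReal.ofReal ((1 / 2) ^ k) * M := by
    intro k
    set n := 2 * (k + 1) with hn
    have hn0 : (0 : ℝ) < n := by exact_mod_cast (by omega : 0 < n)
    have hnβ : 0 < (n : ℝ) ^ β := by positivity
    calc ∫⁻ x, ENNReal.ofReal ((2 * C * (n : ℝ) ^ β)⁻¹ ^ n * ‖h x‖ ^ n) ∂μ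
        = ENNReal.ofReal ((2 * C * (n : ℝ) ^ β)⁻¹ ^ n) * ∫⁻ x, ‖h x‖ₑ ^ n ∂μ := by
          rw [← lintegral_const_mul' _ _ (by simp)]
          refine lintegral_congr fun x => ?_
          rw [ENNReal.ofReal_mul (by positivity), ENNReal.ofReal_pow (norm_nonneg _), ofReal_norm]
      _ ≤ ENNReal.ofReal ((2 * C * (n : ℝ) ^ β)⁻¹ ^ n)
            * (ENNReal.ofReal ((C * (n : ℝ) ^ β) ^ n) * M) := by
          gcongr
          exact hmom n (by omega) ⟨k + 1, by omega⟩
      _ ≤ ENNReal.ofReal ((1 / 2) ^ k) * M := by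
          rw [← mul_assoc, ← ENNReal.ofReal_mul (by positivity), ← mul_pow]
          gcongr
          have e : (2 * C * (n : ℝ) ^ β)⁻¹ * (C * (n : ℝ) ^ β) = 1 / 2 := by field_simp
          rw [e]
          exact pow_le_pow_of_le_one (by norm_num) (by norm_num) (by omega)
  calc ∫⁻ x, ENNReal.ofReal (Real.exp (β / ((2 * C) ^ (1 / β) * Real.exp 1)
        * ‖h x‖ ^ (1 / β))) ∂μ
      ≤ ∫⁻ x, ENNReal.ofReal (Real.exp (2 * β)) * (1 + ∑' k : ℕ, ENNReal.ofReal
        ((2 * C * ((2 * (k + 1) : ℕ) : ℝ) ^ β)⁻¹ ^ (2 * (k + 1)) * ‖h x‖ ^ (2 * (k + 1)))) ∂μ :=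
        lintegral_mono fun x => exp_le_of_forall_even_pow hβ hC (norm_nonneg _)
    _ = ENNReal.ofReal (Real.exp (2 * β)) * (μ univ + ∑' k : ℕ, ∫⁻ x, ENNReal.ofReal
        ((2 * C * ((2 * (k + 1) : ℕ) : ℝ) ^ β)⁻¹ ^ (2 * (k + 1)) * ‖h x‖ ^ (2 * (k + 1))) ∂μ) := by
        rw [lintegral_const_mul' _ _ (by simp), lintegral_add_left measurable_const,
          lintegral_tsum, lintegral_one]
        intro k
        exact ((hh.norm.aemeasurable.pow_const _).const_mul _).ennreal_ofReal
    _ ≤ ENNReal.ofReal (Real.exp (2 * β))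
        * (μ univ + ∑' k : ℕ, ENNReal.ofReal ((1 / 2) ^ k) * M) := by
        gcongr with k
        exact hterm k
    _ < ⊤ := by
        rw [ENNReal.tsum_mul_right, ← ENNReal.ofReal_tsum_of_nonneg (fun k => by positivity)
          (summable_geometric_of_lt_one (by norm_num) (by norm_num))]
        refine ENNReal.mul_lt_top ENNReal.ofReal_lt_top (ENNReal.add_lt_top.2
          ⟨measure_lt_top _ _, ENNReal.mul_lt_top ENNReal.ofReal_lt_top hM⟩)

instance : IsFiniteMeasure mIoo := by
  unfold mIoo
  infer_instance

/-- The finite Hilbert transform is an a.e. limit of functions which are either truncated Hilbert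
transforms or constant. -/
lemma exists_tendsto_FHT {f g : ℝ → ℂ} (hm : Measurable g) (hg : Integrable g)
    (hs : ∀ x, x ∉ Ioo (-1 : ℝ) 1 → g x = 0)
    (hfg : ∀ᵐ x, x ∈ Ioo (-1 : ℝ) 1 → g x = f x) :
    ∃ (c : ℂ) (h : ℕ → ℝ → ℂ), (∀ k, Measurable (h k)) ∧
      (∀ k, ∃ ε > 0, ∀ t, ‖h k t‖ ≤ ‖truncHilbert g ε t‖ ∨ h k t = c) ∧
      ∀ᵐ t ∂mIoo, Tendsto (fun k => h k t) atTop (nhds (FHT f t)) := by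
  classical
  set E := {t | ∃ L, Tendsto (fun ε => (Real.pi : ℂ)⁻¹ * truncHilbert g ε t)
      (nhdsWithin 0 (Ioi 0)) (nhds L)} with hE
  have hEm : MeasurableSet E := measurableSet_exists_tendsto_truncHilbert hm hg
  set c : ℂ := Classical.epsilon fun _ : ℂ => False with hc
  refine ⟨c, fun k t => if t ∈ E then (Real.pi : ℂ)⁻¹ * truncHilbert g (1 / ((k : ℝ) + 1)) t else c,
    fun k => Measurable.ite hEm ((measurable_truncHilbert hm _).const_mul _) measurable_const,
    fun k => ⟨1 / ((k : ℝ) + 1), by positivity, fun t => ?_⟩, ?_⟩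
  · by_cases ht : t ∈ E
    · left
      simp only [ht, if_true]
      rw [norm_mul, norm_inv, Complex.norm_real, Real.norm_of_nonneg Real.pi_pos.le]
      exact mul_le_of_le_one_left (norm_nonneg _)
        (inv_le_one_of_one_le₀ (by linarith [Real.pi_gt_three]))
    · right
      simp [ht]
  · refine ae_restrict_of_forall_mem measurableSet_Ioo fun t ht => ?_
    rw [FHT_eq_limUnder_truncHilbert hg hs hfg ht]
    by_cases htE : t ∈ E
    · simp only [htE, if_true]
      have hseq : Tendsto (fun k : ℕ => 1 / ((k : ℝ) + 1)) atTop (nhdsWithin 0 (Ioi 0)) :=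
        tendsto_nhdsWithin_iff.2 ⟨tendsto_one_div_add_atTop_nhds_zero_nat,
          Eventually.of_forall fun k => by
            rw [mem_Ioi]
            positivity⟩
      exact (tendsto_nhds_limUnder htE).comp hseq
    · simp only [htE, if_false]
      rw [limUnder, lim_eq_of_not_exists htE]
      exact tendsto_const_nhds

/-- for `α > 0`, the finite Hilbert transform maps `L_exp^α` into
`L_exp^(α+1)`. -/
theorem stmt2 (α : ℝ) (hα : 0 < α) (f : ℝ → ℂ) (hf : MemLexpPow α f) :
    MemLexpPow (α + 1) (FHT f) := by
  obtain ⟨hfm, l, hl, hJ⟩ := hf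
  set J := ∫⁻ x, ENNReal.ofReal (Real.exp (l * ‖f x‖ ^ ((1 : ℝ) / α))) ∂mIoo with hJdef
  set g : ℝ → ℂ := (Ioo (-1 : ℝ) 1).indicator (hfm.mk f) with hgdef
  have hgm : Measurable g := hfm.stronglyMeasurable_mk.measurable.indicator measurableSet_Ioo
  have hs : ∀ x, x ∉ Ioo (-1 : ℝ) 1 → g x = 0 := fun x hx => indicator_of_notMem hx _
  have hfg : ∀ᵐ x, x ∈ Ioo (-1 : ℝ) 1 → g x = f x := by
    filter_upwards [(ae_restrict_iff' measurableSet_Ioo).1 hfm.ae_eq_mk] with x hx hxI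
    rw [hgdef, indicator_of_mem hxI, hx hxI]
  set A := (α / l) ^ α with hA
  have hA0 : 0 < A := by positivity
  have hmom : ∀ n : ℕ, 0 < n →
      ∫⁻ x, ‖g x‖ₑ ^ n ≤ ENNReal.ofReal ((A * (n : ℝ) ^ α) ^ n) * J := by
    intro n hn
    have h1 : ∫⁻ x, ‖g x‖ₑ ^ n = ∫⁻ x, ‖f x‖ₑ ^ n ∂mIoo := by
      rw [mIoo, ← lintegral_indicator measurableSet_Ioo]
      refine lintegral_congr_ae ?_
      filter_upwards [hfg] with x hx
      by_cases hxI : x ∈ Ioo (-1 : ℝ) 1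
      · rw [indicator_of_mem hxI, hx hxI]
      · rw [indicator_of_notMem hxI, hs x hxI]
        simp [hn.ne']
    rw [h1]
    exact lintegral_pow_le_of_exp hα hl hn
  have hgi : Integrable g := by
    refine ⟨hgm.aestronglyMeasurable, ?_⟩
    have h1 := hmom 1 one_pos
    simp only [pow_one] at h1
    exact h1.trans_lt (ENNReal.mul_lt_top ENNReal.ofReal_lt_top hJ)
  obtain ⟨c, h, hhm, hhb, hht⟩ := exists_tendsto_FHT hgm hgi hs hfg
  have hFm : AEStronglyMeasurable (FHT f) mIoo :=
    aestronglyMeasurable_of_tendsto_ae atTop (fun k => (hhm k).aestronglyMeasurable) hht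
  refine ⟨hFm, ?_⟩
  refine exists_lintegral_exp_lt_top (C := 256 * A + ‖c‖) (M := J + mIoo univ) hFm (by linarith)
    (by positivity) (ENNReal.add_lt_top.2 ⟨hJ, measure_lt_top _ _⟩) fun n hn he => ?_
  have hn1 : (1 : ℝ) ≤ n := by exact_mod_cast (by omega : 1 ≤ n)
  have hn0 : (0 : ℝ) < n := by linarith
  set B := ENNReal.ofReal (((256 * A + ‖c‖) * (n : ℝ) ^ (α + 1)) ^ n) with hB
  have hk : ∀ k, ∫⁻ t, ‖h k t‖ₑ ^ n ∂mIoo ≤ B * (J + mIoo univ) := by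
    intro k
    obtain ⟨ε, hε, hb⟩ := hhb k
    have hHn := lintegral_truncHilbert_pow_le hgm hgi hs hε hn he
    have hcst : ‖c‖ₑ ^ n ≤ B := by
      rw [← ofReal_norm, ← ENNReal.ofReal_pow (norm_nonneg _)]
      refine ENNReal.ofReal_le_ofReal (pow_le_pow_left₀ (norm_nonneg _) ?_ n)
      have h1 : 1 ≤ (n : ℝ) ^ (α + 1) := Real.one_le_rpow hn1 (by linarith)
      nlinarith [norm_nonneg c]
    have hmain : (256 * (n : ENNReal)) ^ n * ENNReal.ofReal ((A * (n : ℝ) ^ α) ^ n) ≤ B := by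
      have h1 : (256 * (n : ENNReal)) ^ n = ENNReal.ofReal ((256 * n) ^ n) := by
        rw [ENNReal.ofReal_pow (by positivity), ENNReal.ofReal_mul (by norm_num)]
        simp
      rw [h1, ← ENNReal.ofReal_mul (by positivity), ← mul_pow]
      refine ENNReal.ofReal_le_ofReal (pow_le_pow_left₀ (by positivity) ?_ n)
      rw [Real.rpow_add_one hn0.ne']
      have h2 : 0 ≤ ‖c‖ * ((n : ℝ) ^ α * n) := by positivity
      linarith
    calc ∫⁻ t, ‖h k t‖ₑ ^ n ∂mIoo
        ≤ ∫⁻ t, (‖truncHilbert g ε t‖ₑ ^ n + ‖c‖ₑ ^ n) ∂mIoo := by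
          refine lintegral_mono fun t => ?_
          rcases hb t with h1 | h1
          · refine le_trans ?_ le_self_add
            gcongr
            exact enorm_le_iff_norm_le.2 h1
          · rw [h1]
            exact le_add_self
      _ = (∫⁻ t, ‖truncHilbert g ε t‖ₑ ^ n ∂mIoo) + ‖c‖ₑ ^ n * mIoo univ := by
          rw [lintegral_add_right _ measurable_const, lintegral_const]
      _ ≤ (256 * n) ^ n * (ENNReal.ofReal ((A * (n : ℝ) ^ α) ^ n) * J) + B * mIoo univ := by
          gcongr
          refine (lintegral_mono' Measure.restrict_le_self le_rfl).trans (hHn.trans ?_)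
          gcongr
          exact hmom n (by omega)
      _ ≤ B * J + B * mIoo univ := by
          rw [← mul_assoc]
          gcongr
      _ = B * (J + mIoo univ) := by rw [mul_add]
  calc ∫⁻ t, ‖FHT f t‖ₑ ^ n ∂mIoo
      = ∫⁻ t, liminf (fun k => ‖h k t‖ₑ ^ n) atTop ∂mIoo := by
        refine lintegral_congr_ae ?_
        filter_upwards [hht] with t ht
        exact (((ENNReal.continuous_pow n).tendsto _).comp ht.enorm).liminf_eq.symm
    _ ≤ liminf (fun k => ∫⁻ t, ‖h k t‖ₑ ^ n ∂mIoo) atTop :=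
        lintegral_liminf_le fun k => (hhm k).enorm.pow_const n
    _ ≤ B * (J + mIoo univ) :=
        liminf_le_of_le (by isBoundedDefault) fun b hb => by
          obtain ⟨k, hk'⟩ := hb.exists
          exact hk'.trans (hk k)
end

section
/- Let α > 0 and let f be a measurable function on (−1,1) belonging to the Zygmund space L_exp^α, i.e., there exists λ > 0 with ∫_{−1}^{1} exp(λ|f(x)|^{1/α}) dx < ∞. Then f/w ∈ L¹(−1,1) and the function Ť(f) := −w·T(f/w) belongs to L_exp^{α+1}, i.e., there exists μ > 0 with ∫_{−1}^{1} exp(μ|Ť(f)(x)|^{1/(α+1)}) dx < ∞. -/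
open MeasureTheory Filter Set

instance inst_s5 : IsFiniteMeasure mIoo := by unfold mIoo; infer_instance

/-- The Cauchy integral of a function on `(-1, 1)`. -/
noncomputable def cauchyInt (g : ℝ → ℝ) (z : ℂ) : ℂ := ∫ x, (g x : ℂ) / ((x : ℂ) - z) ∂mIoo

/-- The Poisson integral at height `ε`, up to the factor `1 / π`. -/
noncomputable def poissonInt (g : ℝ → ℝ) (ε t : ℝ) : ℝ :=
  ∫ x, g x * (ε / ((x - t) ^ 2 + ε ^ 2)) ∂mIoo

/-- The conjugate Poisson integral at height `ε`, up to the factor `1 / π`. -/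
noncomputable def conjInt (g : ℝ → ℝ) (ε t : ℝ) : ℝ :=
  ∫ x, g x * ((x - t) / ((x - t) ^ 2 + ε ^ 2)) ∂mIoo

lemma re_add_mul_I_pow_bound {n : ℕ} (hn : 1 ≤ n) (u v : ℝ) :
    u ^ (2 * n) ≤ 2 * (((u : ℂ) + v * Complex.I) ^ (2 * n)).re + (27 * n * v) ^ (2 * n) := by
  have hn1 : (1 : ℝ) ≤ n := by exact_mod_cast hn
  have hev : Even (2 * n) := even_two_mul n
  by_cases h : 8 * n * |v| ≤ |u|
  · rcases eq_or_ne u 0 with rfl | hu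
    · have hv : v = 0 := by
        rw [abs_zero] at h
        have : |v| ≤ 0 := by nlinarith [abs_nonneg v]
        simpa using this
      subst hv
      have : 2 * n ≠ 0 := by omega
      simp [this]
    · have hzn : ‖(v / u : ℂ) * Complex.I‖ ≤ 1 / (8 * n) := by
        have : 0 < |u| := abs_pos.2 hu
        simp only [norm_mul, Complex.norm_I, norm_div, Complex.norm_real, mul_one, Real.norm_eq_abs]
        rw [div_le_div_iff₀ this (by positivity)]
        linarith
      have h1 := Finset.norm_prod_one_add_sub_one_le (Finset.range (2 * n))
        (fun _ => (v / u : ℂ) * Complex.I)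
      simp only [Finset.prod_const, Finset.card_range, Finset.sum_const, nsmul_eq_mul] at h1
      set ζ : ℂ := (v / u : ℂ) * Complex.I with hζ
      have h2 : ((2 * n : ℕ) : ℝ) * ‖ζ‖ ≤ 1 / 4 := by
        push_cast
        calc 2 * (n : ℝ) * ‖ζ‖ ≤ 2 * n * (1 / (8 * n)) := by gcongr
          _ = 1 / 4 := by field_simp; norm_num
      have h3 : Real.exp (((2 * n : ℕ) : ℝ) * ‖ζ‖) ≤ 3 / 2 := by
        refine (Real.exp_le_exp.2 h2).trans ?_
        have := Real.exp_bound_div_one_sub_of_interval' (x := 1 / 4) (by norm_num) (by norm_num)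
        linarith
      have h4 : (1 / 2 : ℝ) ≤ ((1 + ζ) ^ (2 * n)).re := by
        have h5 := (Complex.abs_re_le_norm ((1 + ζ) ^ (2 * n) - 1)).trans h1
        rw [Complex.sub_re, Complex.one_re] at h5
        have := (abs_le.1 h5).1
        linarith
      have h6 : ((u : ℂ) + v * Complex.I) = (u : ℂ) * (1 + ζ) := by
        have : (u : ℂ) ≠ 0 := by exact_mod_cast hu
        rw [hζ]; field_simp
      rw [h6, mul_pow, ← Complex.ofReal_pow, Complex.re_ofReal_mul]
      have h7 : 0 ≤ u ^ (2 * n) := hev.pow_nonneg u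
      have h8 : 0 ≤ (27 * n * v) ^ (2 * n) := hev.pow_nonneg _
      nlinarith
  · push Not at h
    have hu : u ^ (2 * n) ≤ (9 * n * |v|) ^ (2 * n) := by
      rw [← hev.pow_abs u]
      gcongr
      nlinarith [abs_nonneg v]
    have hz : ‖((u : ℂ) + v * Complex.I) ^ (2 * n)‖ ≤ (9 * n * |v|) ^ (2 * n) := by
      rw [norm_pow]
      gcongr
      refine (norm_add_le _ _).trans ?_
      simp only [norm_mul, Complex.norm_I, Complex.norm_real, mul_one, Real.norm_eq_abs]
      nlinarith [abs_nonneg v]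
    have hr := (abs_le.1 ((Complex.abs_re_le_norm _).trans hz)).1
    have : (27 * n * v) ^ (2 * n) = 3 ^ (2 * n) * (9 * n * |v|) ^ (2 * n) := by
      rw [← hev.pow_abs (27 * n * v), ← mul_pow, abs_mul, abs_of_nonneg (by positivity)]
      congr 1; ring
    rw [this]
    have h3 : (3 : ℝ) ≤ 3 ^ (2 * n) := le_self_pow₀ (by norm_num) (by omega)
    have h0 : 0 ≤ (9 * n * |v|) ^ (2 * n) := by positivity
    nlinarith

lemma integrable_mul_of_le {g : ℝ → ℂ} (hg : Integrable g mIoo) {k : ℝ → ℂ} (hk : Measurable k)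
    {C : ℝ} (hC : ∀ x, ‖k x‖ ≤ C) : Integrable (fun x => g x * k x) mIoo := by
  refine (Integrable.bdd_mul (c := C) hg hk.aestronglyMeasurable ?_).congr ?_
  · exact Eventually.of_forall hC
  · exact Eventually.of_forall fun x => mul_comm _ _

lemma norm_sub_inv_le {x : ℝ} {z : ℂ} {δ : ℝ} (hδ : 0 < δ) (hz : δ ≤ z.im) :
    ‖((x : ℂ) - z)⁻¹‖ ≤ δ⁻¹ := by
  rw [norm_inv]
  gcongr
  refine hz.trans ((le_abs_self _).trans ?_)
  simpa using Complex.abs_im_le_norm ((x : ℂ) - z)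

lemma differentiableAt_cauchyInt {g : ℝ → ℝ} (hg : Integrable g mIoo) {z : ℂ} (hz : 0 < z.im) :
    DifferentiableAt ℂ (cauchyInt g) z := by
  have hgc : Integrable (fun x => (g x : ℂ)) mIoo := hg.ofReal
  have hopen : IsOpen {y : ℂ | z.im / 2 < y.im} := isOpen_lt continuous_const Complex.continuous_im
  have hmem : {y : ℂ | z.im / 2 < y.im} ∈ nhds z := hopen.mem_nhds (by
    simp only [Set.mem_ofPred_eq]; linarith)
  have hI : ∀ y : ℂ, z.im / 2 < y.im → Integrable (fun x : ℝ => (g x : ℂ) / ((x : ℂ) - y)) mIoo := by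
    intro y hy
    simp_rw [div_eq_mul_inv]
    exact integrable_mul_of_le hgc (by fun_prop)
      (fun x => norm_sub_inv_le (half_pos hz) hy.le)
  refine (hasDerivAt_integral_of_dominated_loc_of_deriv_le (μ := mIoo)
    (F := fun y x => (g x : ℂ) / ((x : ℂ) - y)) (F' := fun y x => (g x : ℂ) * (((x : ℂ) - y)⁻¹ ^ 2))
    (bound := fun x => |g x| * ((z.im / 2)⁻¹ ^ 2)) hmem ?_ ?_ ?_ ?_ ?_ ?_).2.differentiableAt
  · filter_upwards [hmem] with y hy using (hI y hy).1
  · exact hI z (by linarith)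
  · exact hgc.1.mul (by fun_prop)
  · refine Eventually.of_forall fun x y hy => ?_
    rw [norm_mul, norm_pow, Complex.norm_real, Real.norm_eq_abs]
    gcongr
    exact norm_sub_inv_le (half_pos hz) (le_of_lt hy)
  · exact hg.abs.mul_const _
  · refine Eventually.of_forall fun x y hy => ?_
    have hne : (x : ℂ) - y ≠ 0 := by
      intro h0
      have := congrArg Complex.im h0
      simp at this
      have hy' : z.im / 2 < y.im := hy
      linarith
    have h1 : HasDerivAt (fun y : ℂ => (x : ℂ) - y) (-1) y := by
      simpa using (hasDerivAt_id y).const_sub (x : ℂ)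
    have := (h1.inv hne).const_mul (g x : ℂ)
    refine (this.congr_deriv ?_)
    field_simp

lemma cauchyInt_eq {g : ℝ → ℝ} (hg : Integrable g mIoo) {ε : ℝ} (hε : 0 < ε) (t : ℝ) :
    cauchyInt g (t + ε * Complex.I) = (conjInt g ε t : ℂ) + poissonInt g ε t * Complex.I := by
  have hI : Integrable (fun x : ℝ => (g x : ℂ) / ((x : ℂ) - (t + ε * Complex.I))) mIoo := by
    simp_rw [div_eq_mul_inv]
    exact integrable_mul_of_le hg.ofReal (by fun_prop)
      (fun x => norm_sub_inv_le hε (by simp))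
  have key : ∀ x : ℝ, (g x : ℂ) / ((x : ℂ) - (t + ε * Complex.I)) =
      ((g x * ((x - t) / ((x - t) ^ 2 + ε ^ 2)) : ℝ) : ℂ) +
        ((g x * (ε / ((x - t) ^ 2 + ε ^ 2)) : ℝ) : ℂ) * Complex.I := by
    intro x
    have hpos : 0 < (x - t) ^ 2 + ε ^ 2 := by positivity
    have h1 : (((x - t) ^ 2 + ε ^ 2 : ℝ) : ℂ) ≠ 0 := by exact_mod_cast hpos.ne'
    have h2 : (x : ℂ) - (t + ε * Complex.I) ≠ 0 := by
      intro h0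
      have := congrArg Complex.im h0
      simp at this
      exact hε.ne' this
    push_cast at h1 ⊢
    field_simp
    linear_combination ((ε : ℂ) ^ 2 * g x) * Complex.I_sq
  have hre : ∀ x : ℝ, ((g x : ℂ) / ((x : ℂ) - (t + ε * Complex.I))).re =
      g x * ((x - t) / ((x - t) ^ 2 + ε ^ 2)) := by
    intro x; rw [key x]; simp [-Complex.ofReal_mul, -Complex.ofReal_div]
  have him : ∀ x : ℝ, ((g x : ℂ) / ((x : ℂ) - (t + ε * Complex.I))).im =
      g x * (ε / ((x - t) ^ 2 + ε ^ 2)) := by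
    intro x; rw [key x]; simp [-Complex.ofReal_mul, -Complex.ofReal_div]
  unfold cauchyInt conjInt poissonInt
  rw [← integral_re_add_im hI]
  congr 1
  · simp only [← hre]; rfl
  · simp only [← him]; rfl

lemma norm_cauchyInt_le {g : ℝ → ℝ} (hg : Integrable g mIoo) {z : ℂ} (hz : 1 < ‖z‖) :
    ‖cauchyInt g z‖ ≤ (∫ x, |g x| ∂mIoo) / (‖z‖ - 1) := by
  have h1 : ‖cauchyInt g z‖ ≤ ∫ x, |g x| * (‖z‖ - 1)⁻¹ ∂mIoo := by
    refine norm_integral_le_of_norm_le (hg.abs.mul_const _) ?_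
    unfold mIoo
    filter_upwards [ae_restrict_mem measurableSet_Ioo] with x hx
    rw [norm_div, Complex.norm_real, Real.norm_eq_abs, div_eq_mul_inv]
    have hx' : |x| ≤ 1 := abs_le.2 ⟨hx.1.le, hx.2.le⟩
    have : ‖z‖ - 1 ≤ ‖(x : ℂ) - z‖ := by
      have h := norm_sub_norm_le z (x : ℂ)
      rw [norm_sub_rev, Complex.norm_real, Real.norm_eq_abs] at h
      linarith
    have h0 : 0 < ‖z‖ - 1 := by linarith
    gcongr
  rw [integral_mul_const] at h1
  rwa [div_eq_mul_inv]

lemma continuous_cauchyInt {g : ℝ → ℝ} (hg : Integrable g mIoo) {ε : ℝ} (hε : 0 < ε) :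
    Continuous fun t : ℝ => cauchyInt g (t + ε * Complex.I) := by
  rw [continuous_iff_continuousAt]
  intro t
  have h := (differentiableAt_cauchyInt hg (z := t + ε * Complex.I) (by simpa using hε)).continuousAt
  exact ContinuousAt.comp (f := fun t : ℝ => (t : ℂ) + ε * Complex.I) h (by fun_prop)

lemma continuous_conjInt {g : ℝ → ℝ} (hg : Integrable g mIoo) {ε : ℝ} (hε : 0 < ε) :
    Continuous (conjInt g ε) := by
  have : conjInt g ε = fun t : ℝ => (cauchyInt g (t + ε * Complex.I)).re := by
    funext t; rw [cauchyInt_eq hg hε]; simp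
  rw [this]
  exact Complex.continuous_re.comp (continuous_cauchyInt hg hε)

lemma continuous_poissonInt {g : ℝ → ℝ} (hg : Integrable g mIoo) {ε : ℝ} (hε : 0 < ε) :
    Continuous (poissonInt g ε) := by
  have : poissonInt g ε = fun t : ℝ => (cauchyInt g (t + ε * Complex.I)).im := by
    funext t; rw [cauchyInt_eq hg hε]; simp
  rw [this]
  exact Complex.continuous_im.comp (continuous_cauchyInt hg hε)

lemma norm_integral_cauchyInt_pow_le {g : ℝ → ℝ} (hg : Integrable g mIoo) {ε : ℝ} (hε : 0 < ε)
    {n : ℕ} (hn : 1 ≤ n) {R : ℝ} (hR2 : 2 ≤ R) (hRM : 2 * (∫ x, |g x| ∂mIoo) ≤ R) :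
    ‖∫ t in (-R)..R, cauchyInt g (t + ε * Complex.I) ^ (2 * n)‖ ≤
      16 * (∫ x, |g x| ∂mIoo) ^ 2 / R := by
  set M := ∫ x, |g x| ∂mIoo with hM
  have hM0 : 0 ≤ M := integral_nonneg fun x => abs_nonneg _
  have hR0 : 0 < R := by linarith
  set z₁ : ℂ := ⟨-R, ε⟩
  set z₂ : ℂ := ⟨R, ε + R⟩
  have hbd : ∀ z : ℂ, R ≤ ‖z‖ → ‖cauchyInt g z ^ (2 * n)‖ ≤ 4 * M ^ 2 / R ^ 2 := by
    intro z hz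
    have h1 : ‖cauchyInt g z‖ ≤ 2 * M / R := by
      refine (norm_cauchyInt_le hg (by linarith)).trans ?_
      rw [div_le_div_iff₀ (by linarith) hR0]
      nlinarith
    have h2 : 2 * M / R ≤ 1 := by rw [div_le_one hR0]; exact hRM
    rw [norm_pow]
    calc ‖cauchyInt g z‖ ^ (2 * n) ≤ (2 * M / R) ^ (2 * n) := by gcongr
      _ ≤ (2 * M / R) ^ 2 := pow_le_pow_of_le_one (by positivity) h2 (by omega)
      _ = _ := by ring
  have hrect := Complex.integral_boundary_rect_eq_zero_of_differentiableOn
    (fun z => cauchyInt g z ^ (2 * n)) z₁ z₂ (by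
      intro z hz
      have him : 0 < z.im := by
        have := hz.2
        simp only [z₁, z₂, Set.mem_preimage, Set.uIcc_of_le (by linarith : ε ≤ ε + R)] at this
        linarith [this.1]
      exact ((differentiableAt_cauchyInt hg him).pow _).differentiableWithinAt)
  simp only [z₁, z₂] at hrect
  have hA : ‖∫ x in (-R)..R, cauchyInt g ((x : ℂ) + ((ε + R : ℝ) : ℂ) * Complex.I) ^ (2 * n)‖ ≤
      4 * M ^ 2 / R ^ 2 * |R - -R| := by
    refine intervalIntegral.norm_integral_le_of_norm_le_const fun x _ => hbd _ ?_
    refine le_trans ?_ (Complex.abs_im_le_norm _)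
    refine le_trans ?_ (le_abs_self _)
    simp; linarith
  have hside : ∀ a : ℝ, R ≤ |a| →
      ‖∫ y in ε..(ε + R), cauchyInt g ((a : ℂ) + (y : ℂ) * Complex.I) ^ (2 * n)‖ ≤
      4 * M ^ 2 / R ^ 2 * |ε + R - ε| := by
    intro a ha
    refine intervalIntegral.norm_integral_le_of_norm_le_const fun x _ => hbd _ ?_
    refine le_trans ?_ (Complex.abs_re_le_norm _)
    simpa using ha
  have hB := hside R (le_abs_self R)
  have hC := hside (-R) (by rw [abs_neg]; exact le_abs_self R)
  have heq : ∫ t in (-R)..R, cauchyInt g (t + ε * Complex.I) ^ (2 * n) =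
      (∫ x in (-R)..R, cauchyInt g ((x : ℂ) + ((ε + R : ℝ) : ℂ) * Complex.I) ^ (2 * n)) -
      Complex.I • (∫ y in ε..(ε + R), cauchyInt g ((R : ℂ) + (y : ℂ) * Complex.I) ^ (2 * n)) +
      Complex.I • (∫ y in ε..(ε + R), cauchyInt g (((-R : ℝ) : ℂ) + (y : ℂ) * Complex.I) ^ (2 * n))
      := by
    linear_combination hrect
  rw [heq]
  refine (norm_add_le _ _).trans ((add_le_add_left (norm_sub_le _ _) _).trans ?_)
  rw [norm_smul, norm_smul, Complex.norm_I, one_mul, one_mul]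
  refine (add_le_add (add_le_add hA hB) hC).trans (le_of_eq ?_)
  rw [show R - -R = 2 * R by ring, show ε + R - ε = R by ring, abs_of_pos hR0,
    abs_of_pos (by linarith : 0 < 2 * R)]
  field_simp
  ring

lemma lintegral_mul_pow_le {X : Type*} [MeasurableSpace X] {μ : Measure X} {G K : X → ENNReal}
    (hG : AEMeasurable G μ) (hK : AEMeasurable K μ)
    (hK1 : ∫⁻ x, K x ∂μ ≤ 1) {m : ℕ} (hm : 1 ≤ m) :
    (∫⁻ x, G x * K x ∂μ) ^ m ≤ ∫⁻ x, G x ^ m * K x ∂μ := by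
  have hm0 : (0 : ℝ) < m := by exact_mod_cast hm
  have hm1 : (1 : ℝ) ≤ m := by exact_mod_cast hm
  have hq : (0 : ℝ) ≤ 1 - 1 / m := by
    rw [sub_nonneg, div_le_one hm0]; exact hm1
  have h := ENNReal.lintegral_mul_norm_pow_le (μ := μ) (f := fun x => G x ^ m * K x) (g := K)
    ((hG.pow_const m).mul hK) hK (p := 1 / m) (q := 1 - 1 / m) (by positivity) hq (by ring)
  have h1 : ∀ x, (G x ^ m * K x) ^ (1 / m : ℝ) * K x ^ (1 - 1 / m : ℝ) = G x * K x := by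
    intro x
    rw [ENNReal.mul_rpow_of_nonneg _ _ (by positivity), mul_assoc, ← ENNReal.rpow_natCast,
      ← ENNReal.rpow_mul, mul_one_div_cancel hm0.ne', ENNReal.rpow_one,
      ← ENNReal.rpow_add_of_nonneg _ _ (by positivity) hq]
    simp
  simp only [h1] at h
  have h2 : ∫⁻ x, G x * K x ∂μ ≤ (∫⁻ x, G x ^ m * K x ∂μ) ^ (1 / m : ℝ) := by
    refine h.trans ?_
    calc _ ≤ (∫⁻ x, G x ^ m * K x ∂μ) ^ (1 / m : ℝ) * 1 := by
          gcongr
          exact ENNReal.rpow_le_one hK1 hq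
      _ = _ := mul_one _
  calc _ ≤ ((∫⁻ x, G x ^ m * K x ∂μ) ^ (1 / m : ℝ)) ^ m := by gcongr
    _ = _ := by
      rw [← ENNReal.rpow_natCast, ← ENNReal.rpow_mul, one_div_mul_cancel hm0.ne', ENNReal.rpow_one]

open ProbabilityTheory in
lemma lintegral_poissonInt_pow_le {g : ℝ → ℝ} (hg : Integrable g mIoo) {ε : ℝ} (hε : 0 < ε)
    {m : ℕ} (hm : 1 ≤ m) :
    ∫⁻ t, ‖poissonInt g ε t‖ₑ ^ m ≤ ENNReal.ofReal Real.pi ^ m * ∫⁻ x, ‖g x‖ₑ ^ m ∂mIoo := by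
  lift ε to NNReal using hε.le
  have hε0 : ε ≠ 0 := by rintro rfl; simp at hε
  have hgm : AEMeasurable (fun x => ‖g x‖ₑ) mIoo := hg.1.enorm
  have hjm : Measurable (Function.uncurry fun t x : ℝ => cauchyPDF t ε x) := by
    unfold cauchyPDF cauchyPDFReal Function.uncurry
    fun_prop
  have hpt : ∀ t, ‖poissonInt g ε t‖ₑ ≤
      ENNReal.ofReal Real.pi * ∫⁻ x, ‖g x‖ₑ * cauchyPDF t ε x ∂mIoo := by
    intro t
    refine (enorm_integral_le_lintegral_enorm _).trans (le_of_eq ?_)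
    rw [← lintegral_const_mul' _ _ (by finiteness)]
    refine lintegral_congr fun x => ?_
    rw [enorm_mul, mul_left_comm, cauchyPDF_def, ← ENNReal.ofReal_mul Real.pi_pos.le,
      Real.enorm_of_nonneg (by positivity : 0 ≤ (ε : ℝ) / ((x - t) ^ 2 + ε ^ 2)),
      cauchyPDFReal_def]
    congr 2
    field_simp
  have hK1 : ∀ t, ∫⁻ x, cauchyPDF t ε x ∂mIoo ≤ 1 := fun t =>
    (lintegral_mono' Measure.restrict_le_self le_rfl).trans_eq (lintegral_cauchyPDF_eq_one t hε0)
  calc ∫⁻ t, ‖poissonInt g ε t‖ₑ ^ m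
      ≤ ∫⁻ t, ENNReal.ofReal Real.pi ^ m * ∫⁻ x, ‖g x‖ₑ ^ m * cauchyPDF t ε x ∂mIoo := by
        refine lintegral_mono fun t => ?_
        refine (pow_le_pow_left' (hpt t) m).trans ?_
        rw [mul_pow]
        gcongr
        exact lintegral_mul_pow_le hgm (measurable_cauchyPDF t ε).aemeasurable
          (hK1 t) hm
    _ = ENNReal.ofReal Real.pi ^ m * ∫⁻ t, ∫⁻ x, ‖g x‖ₑ ^ m * cauchyPDF t ε x ∂mIoo := by
        rw [lintegral_const_mul' _ _ (by finiteness)]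
    _ = ENNReal.ofReal Real.pi ^ m * ∫⁻ x, (∫⁻ t, ‖g x‖ₑ ^ m * cauchyPDF t ε x) ∂mIoo := by
        rw [lintegral_lintegral_swap]
        exact ((hgm.pow_const m).comp_snd).mul hjm.aemeasurable
    _ = _ := by
        congr 1
        refine lintegral_congr fun x => ?_
        rw [lintegral_const_mul' _ _ (by finiteness)]
        have : ∀ t, cauchyPDF t ε x = cauchyPDF x ε t := by
          intro t
          simp only [cauchyPDF_def, cauchyPDFReal_def]
          congr 3; ring
        simp only [this, lintegral_cauchyPDF_eq_one x hε0, mul_one]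

lemma ofReal_intervalIntegral_pow {u : ℝ → ℝ} (hu : Continuous u) {n : ℕ} {R : ℝ} (hR : 0 ≤ R) :
    ENNReal.ofReal (∫ t in (-R)..R, u t ^ (2 * n)) = ∫⁻ t in Set.Ioc (-R) R, ‖u t‖ₑ ^ (2 * n) := by
  rw [intervalIntegral.integral_of_le (by linarith), ofReal_integral_eq_lintegral_ofReal]
  · refine lintegral_congr fun t => ?_
    rw [← enorm_pow, Real.enorm_of_nonneg ((even_two_mul n).pow_nonneg _)]
  · exact ((hu.pow _).integrableOn_Icc).mono_set Set.Ioc_subset_Icc_self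
  · exact Eventually.of_forall fun t => (even_two_mul n).pow_nonneg _

lemma lintegral_conjInt_pow_le {g : ℝ → ℝ} (hg : Integrable g mIoo) {ε : ℝ} (hε : 0 < ε)
    {n : ℕ} (hn : 1 ≤ n) :
    ∫⁻ t, ‖conjInt g ε t‖ₑ ^ (2 * n) ∂mIoo ≤
      ENNReal.ofReal (27 * n * Real.pi) ^ (2 * n) * ∫⁻ x, ‖g x‖ₑ ^ (2 * n) ∂mIoo := by
  set M := ∫ x, |g x| ∂mIoo with hM
  set A := ENNReal.ofReal (27 * n * Real.pi) ^ (2 * n) * ∫⁻ x, ‖g x‖ₑ ^ (2 * n) ∂mIoo with hA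
  have hu := continuous_conjInt hg hε
  have hv := continuous_poissonInt hg hε
  have hF := continuous_cauchyInt hg hε
  have hR : ∀ R : ℝ, 2 ≤ R → 2 * M ≤ R → ∫⁻ t, ‖conjInt g ε t‖ₑ ^ (2 * n) ∂mIoo ≤
      ENNReal.ofReal (32 * M ^ 2 / R) + A := by
    intro R hR2 hRM
    have hR0 : 0 ≤ R := by linarith
    have h1 : ∫ t in (-R)..R, conjInt g ε t ^ (2 * n) ≤
        2 * (∫ t in (-R)..R, cauchyInt g (t + ε * Complex.I) ^ (2 * n)).re +
          ∫ t in (-R)..R, (27 * n * poissonInt g ε t) ^ (2 * n) := by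
      have hre : (∫ t in (-R)..R, cauchyInt g (t + ε * Complex.I) ^ (2 * n)).re =
          ∫ t in (-R)..R, (cauchyInt g (t + ε * Complex.I) ^ (2 * n)).re := by
        have := Complex.reCLM.intervalIntegral_comp_comm (μ := volume) (a := -R) (b := R)
          ((hF.pow (2 * n)).intervalIntegrable _ _)
        simpa using this.symm
      have hc1 : Continuous fun t : ℝ => (cauchyInt g (t + ε * Complex.I) ^ (2 * n)).re :=
        Complex.continuous_re.comp (hF.pow _)
      have hc2 : Continuous fun t : ℝ => (27 * n * poissonInt g ε t) ^ (2 * n) := by fun_prop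
      rw [hre, ← intervalIntegral.integral_const_mul, ← intervalIntegral.integral_add
        ((hc1.const_mul 2).intervalIntegrable _ _) (hc2.intervalIntegrable _ _)]
      refine intervalIntegral.integral_mono_on (by linarith)
        ((hu.pow _).intervalIntegrable _ _)
        (((hc1.const_mul 2).add hc2).intervalIntegrable _ _) fun t _ => ?_
      rw [cauchyInt_eq hg hε]
      exact re_add_mul_I_pow_bound hn _ _
    have h2 : 2 * (∫ t in (-R)..R, cauchyInt g (t + ε * Complex.I) ^ (2 * n)).re ≤
        32 * M ^ 2 / R := by
      have := ((le_abs_self _).trans (Complex.abs_re_le_norm _)).trans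
        (norm_integral_cauchyInt_pow_le hg hε hn hR2 hRM)
      calc _ ≤ 2 * (16 * M ^ 2 / R) := by gcongr
        _ = _ := by ring
    calc ∫⁻ t, ‖conjInt g ε t‖ₑ ^ (2 * n) ∂mIoo
        ≤ ∫⁻ t in Set.Ioc (-R) R, ‖conjInt g ε t‖ₑ ^ (2 * n) :=
          lintegral_mono_set fun t ht => ⟨by linarith [ht.1], by linarith [ht.2]⟩
      _ = ENNReal.ofReal (∫ t in (-R)..R, conjInt g ε t ^ (2 * n)) :=
          (ofReal_intervalIntegral_pow hu hR0).symm
      _ ≤ ENNReal.ofReal (32 * M ^ 2 / R + ∫ t in (-R)..R, (27 * n * poissonInt g ε t) ^ (2 * n)) :=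
          ENNReal.ofReal_le_ofReal (by linarith)
      _ ≤ ENNReal.ofReal (32 * M ^ 2 / R) +
          ENNReal.ofReal (∫ t in (-R)..R, (27 * n * poissonInt g ε t) ^ (2 * n)) :=
          ENNReal.ofReal_add_le
      _ ≤ _ := by
        gcongr
        rw [ofReal_intervalIntegral_pow (by fun_prop) hR0]
        calc _ ≤ ∫⁻ t, ‖27 * n * poissonInt g ε t‖ₑ ^ (2 * n) := setLIntegral_le_lintegral _ _
          _ = ENNReal.ofReal (27 * n) ^ (2 * n) * ∫⁻ t, ‖poissonInt g ε t‖ₑ ^ (2 * n) := by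
            rw [← lintegral_const_mul' _ _ (by finiteness)]
            refine lintegral_congr fun t => ?_
            rw [enorm_mul, mul_pow, Real.enorm_of_nonneg (by positivity)]
          _ ≤ ENNReal.ofReal (27 * n) ^ (2 * n) * (ENNReal.ofReal Real.pi ^ (2 * n) *
              ∫⁻ x, ‖g x‖ₑ ^ (2 * n) ∂mIoo) := by
            gcongr
            exact lintegral_poissonInt_pow_le hg hε (by omega)
          _ = A := by
            rw [hA, ← mul_assoc, ← mul_pow, ← ENNReal.ofReal_mul (by positivity)]
  have hlim : Tendsto (fun R : ℝ => ENNReal.ofReal (32 * M ^ 2 / R) + A) atTop (nhds (0 + A)) := by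
    refine Tendsto.add ?_ tendsto_const_nhds
    rw [← ENNReal.ofReal_zero]
    exact ENNReal.tendsto_ofReal (tendsto_const_nhds.div_atTop tendsto_id)
  rw [zero_add] at hlim
  refine ge_of_tendsto hlim ?_
  filter_upwards [eventually_ge_atTop 2, eventually_ge_atTop (2 * M)] with R h1 h2 using hR R h1 h2

/-- The truncated Hilbert kernel. -/
noncomputable def truncKer (ε y : ℝ) : ℝ := if ε < |y| then y⁻¹ else 0

/-- The truncated finite Hilbert transform, up to the factor `1 / π`. -/
noncomputable def truncInt (f : ℝ → ℂ) (ε t : ℝ) : ℂ :=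
  ∫ x, f x * (truncKer ε (x - t) : ℂ) ∂mIoo

/-- A continuous majorant of the truncated finite Hilbert transform. -/
noncomputable def hilbertMaj (f : ℝ → ℂ) (ε t : ℝ) : ℝ :=
  |conjInt (fun x => (f x).re) ε t| + |conjInt (fun x => (f x).im) ε t| +
    |poissonInt (fun x => ‖f x‖) ε t|

lemma measurable_truncKer : Measurable fun p : ℝ × ℝ => truncKer p.1 p.2 := by
  unfold truncKer
  exact Measurable.ite (measurableSet_lt (by fun_prop) (by fun_prop)) (by fun_prop) (by fun_prop)

lemma abs_truncKer_le {ε : ℝ} (hε : 0 < ε) (y : ℝ) : |truncKer ε y| ≤ ε⁻¹ := by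
  unfold truncKer
  split_ifs with h
  · rw [abs_inv]; gcongr
  · simp [hε.le]

lemma abs_truncKer_sub_le {ε : ℝ} (hε : 0 < ε) (y : ℝ) :
    |truncKer ε y - y / (y ^ 2 + ε ^ 2)| ≤ ε / (y ^ 2 + ε ^ 2) := by
  have hp : 0 < y ^ 2 + ε ^ 2 := by positivity
  unfold truncKer
  split_ifs with h
  · have hy : 0 < |y| := hε.trans h
    have hy0 : y ≠ 0 := abs_pos.1 hy
    have : y⁻¹ - y / (y ^ 2 + ε ^ 2) = ε ^ 2 / (y * (y ^ 2 + ε ^ 2)) := by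
      field_simp; ring
    rw [this, abs_div, abs_mul, abs_of_pos hp, abs_of_pos (by positivity : 0 < ε ^ 2),
      div_le_div_iff₀ (by positivity) hp]
    have : ε * ε * (y ^ 2 + ε ^ 2) ≤ ε * |y| * (y ^ 2 + ε ^ 2) := by gcongr
    nlinarith
  · push Not at h
    rw [zero_sub, abs_neg, abs_div, abs_of_pos hp]
    gcongr

lemma norm_truncInt_le {f : ℝ → ℂ} (hf : Integrable f mIoo) {ε : ℝ} (hε : 0 < ε) (t : ℝ) :
    ‖truncInt f ε t‖ ≤ hilbertMaj f ε t := by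
  set q : ℝ → ℝ := fun x => (x - t) / ((x - t) ^ 2 + ε ^ 2) with hq
  have hT : Integrable (fun x => f x * (truncKer ε (x - t) : ℂ)) mIoo := by
    refine integrable_mul_of_le hf ?_ (C := ε⁻¹) fun x => ?_
    · exact Complex.measurable_ofReal.comp
        (measurable_truncKer.comp (by fun_prop : Measurable fun x : ℝ => (ε, x - t)))
    · rw [Complex.norm_real]; exact abs_truncKer_le hε _
  have hqb : ∀ x, |q x| ≤ ε⁻¹ := by
    intro x
    simp only [hq]
    rw [abs_div, abs_of_pos (by positivity : 0 < (x - t) ^ 2 + ε ^ 2),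
      div_le_iff₀ (by positivity)]
    have h1 : |x - t| * ε ≤ (x - t) ^ 2 + ε ^ 2 := by
      rw [← sq_abs (x - t)]
      nlinarith [sq_nonneg (|x - t| - ε), sq_nonneg (|x - t| + ε)]
    calc |x - t| = ε⁻¹ * (|x - t| * ε) := by field_simp
      _ ≤ _ := by gcongr
  have hQ : Integrable (fun x => f x * (q x : ℂ)) mIoo := by
    refine integrable_mul_of_le hf (by fun_prop) (C := ε⁻¹) fun x => ?_
    rw [Complex.norm_real]; exact hqb x
  have hQeq : ∫ x, f x * (q x : ℂ) ∂mIoo =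
      (conjInt (fun x => (f x).re) ε t : ℂ) + conjInt (fun x => (f x).im) ε t * Complex.I := by
    rw [← integral_re_add_im hQ]
    simp [conjInt, hq, -Complex.ofReal_div]
  have hP : Integrable (fun x => ‖f x‖ * (ε / ((x - t) ^ 2 + ε ^ 2))) mIoo := by
    have h := integrable_mul_of_le hf.norm.ofReal
      (k := fun x : ℝ => ((ε / ((x - t) ^ 2 + ε ^ 2) : ℝ) : ℂ)) (by fun_prop) (C := ε⁻¹) fun x => by
        rw [Complex.norm_real, Real.norm_of_nonneg (by positivity), div_le_iff₀ (by positivity)]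
        have : ε⁻¹ * ε ^ 2 = ε := by field_simp
        have h2 : 0 ≤ ε⁻¹ * (x - t) ^ 2 := by positivity
        nlinarith
    simpa [-Complex.ofReal_div] using h.re
  have hdiff : ‖(∫ x, f x * (truncKer ε (x - t) : ℂ) ∂mIoo) - ∫ x, f x * (q x : ℂ) ∂mIoo‖ ≤
      poissonInt (fun x => ‖f x‖) ε t := by
    rw [← integral_sub hT hQ]
    refine norm_integral_le_of_norm_le hP (Eventually.of_forall fun x => ?_)
    rw [← mul_sub, norm_mul, ← Complex.ofReal_sub, Complex.norm_real]
    gcongr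
    exact abs_truncKer_sub_le hε _
  unfold truncInt hilbertMaj
  calc _ ≤ ‖∫ x, f x * (q x : ℂ) ∂mIoo‖ + ‖(∫ x, f x * (truncKer ε (x - t) : ℂ) ∂mIoo) -
        ∫ x, f x * (q x : ℂ) ∂mIoo‖ := norm_le_norm_add_norm_sub' _ _
    _ ≤ _ := by
      refine add_le_add ?_ (hdiff.trans (le_abs_self _))
      rw [hQeq]
      refine (norm_add_le _ _).trans (le_of_eq ?_)
      simp

lemma continuous_hilbertMaj {f : ℝ → ℂ} (hf : Integrable f mIoo) {ε : ℝ} (hε : 0 < ε) :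
    Continuous (hilbertMaj f ε) :=
  ((continuous_conjInt hf.re hε).abs.add (continuous_conjInt hf.im hε).abs).add
    (continuous_poissonInt hf.norm hε).abs

lemma ENNReal.add_add_pow_le (a b c : ENNReal) (m : ℕ) :
    (a + b + c) ^ m ≤ 3 ^ m * (a ^ m + b ^ m + c ^ m) := by
  have h : ∀ d, a ≤ d → b ≤ d → c ≤ d → (a + b + c) ^ m ≤ 3 ^ m * d ^ m := by
    intro d ha hb hc
    rw [← mul_pow]
    gcongr
    calc a + b + c ≤ d + d + d := by gcongr
      _ = 3 * d := by ring
  rcases le_total a b with hab | hab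
  · rcases le_total b c with hbc | hbc
    · exact (h c (hab.trans hbc) hbc le_rfl).trans (by gcongr; exact le_add_self)
    · exact (h b hab le_rfl hbc).trans (by gcongr; exact le_add_self.trans le_self_add)
  · rcases le_total a c with hac | hac
    · exact (h c hac (hab.trans hac) le_rfl).trans (by gcongr; exact le_add_self)
    · exact (h a le_rfl hab hac).trans (by gcongr; exact le_self_add.trans le_self_add)

lemma lintegral_hilbertMaj_pow_le {f : ℝ → ℂ} (hf : Integrable f mIoo) {ε : ℝ} (hε : 0 < ε)
    {n : ℕ} (hn : 1 ≤ n) :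
    ∫⁻ t, ‖hilbertMaj f ε t‖ₑ ^ (2 * n) ∂mIoo ≤
      ENNReal.ofReal (243 * n * Real.pi) ^ (2 * n) * ∫⁻ x, ‖f x‖ₑ ^ (2 * n) ∂mIoo := by
  set B := ENNReal.ofReal (27 * n * Real.pi) ^ (2 * n) * ∫⁻ x, ‖f x‖ₑ ^ (2 * n) ∂mIoo with hB
  have hn1 : (1 : ℝ) ≤ n := by exact_mod_cast hn
  have hre : ∫⁻ t, ‖conjInt (fun x => (f x).re) ε t‖ₑ ^ (2 * n) ∂mIoo ≤ B := by
    refine (lintegral_conjInt_pow_le hf.re hε hn).trans ?_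
    rw [hB]
    gcongr with x
    exact enorm_le_iff_norm_le.2 (Complex.abs_re_le_norm _)
  have him : ∫⁻ t, ‖conjInt (fun x => (f x).im) ε t‖ₑ ^ (2 * n) ∂mIoo ≤ B := by
    refine (lintegral_conjInt_pow_le hf.im hε hn).trans ?_
    rw [hB]
    gcongr with x
    exact enorm_le_iff_norm_le.2 (Complex.abs_im_le_norm _)
  have hpo : ∫⁻ t, ‖poissonInt (fun x => ‖f x‖) ε t‖ₑ ^ (2 * n) ∂mIoo ≤ B := by
    refine (lintegral_mono' Measure.restrict_le_self le_rfl).trans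
      ((lintegral_poissonInt_pow_le hf.norm hε (by omega)).trans ?_)
    simp only [enorm_norm]
    rw [hB]
    gcongr
    nlinarith [Real.pi_pos]
  have hm1 : Measurable fun t => ‖conjInt (fun x => (f x).re) ε t‖ₑ ^ (2 * n) :=
    (continuous_conjInt hf.re hε).measurable.enorm.pow_const _
  have hm2 : Measurable fun t => ‖conjInt (fun x => (f x).im) ε t‖ₑ ^ (2 * n) :=
    (continuous_conjInt hf.im hε).measurable.enorm.pow_const _
  calc ∫⁻ t, ‖hilbertMaj f ε t‖ₑ ^ (2 * n) ∂mIoo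
      ≤ ∫⁻ t, 3 ^ (2 * n) * (‖conjInt (fun x => (f x).re) ε t‖ₑ ^ (2 * n) +
          ‖conjInt (fun x => (f x).im) ε t‖ₑ ^ (2 * n) +
          ‖poissonInt (fun x => ‖f x‖) ε t‖ₑ ^ (2 * n)) ∂mIoo := by
        refine lintegral_mono fun t => le_trans ?_ (ENNReal.add_add_pow_le _ _ _ _)
        gcongr
        unfold hilbertMaj
        refine (enorm_add_le _ _).trans (add_le_add ((enorm_add_le _ _).trans ?_) ?_) <;>
          simp only [Real.enorm_abs, le_refl]
    _ ≤ 3 ^ (2 * n) * (B + B + B) := by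
        rw [lintegral_const_mul' _ _ (by finiteness), lintegral_add_left (by fun_prop),
          lintegral_add_left hm1]
        gcongr
    _ = 3 ^ (2 * n) * 3 * B := by ring
    _ ≤ 3 ^ (2 * n) * 3 ^ (2 * n) * B := by
        gcongr
        exact le_self_pow₀ (by norm_num) (by omega)
    _ = _ := by
        rw [hB, ← mul_assoc, ← mul_pow, ← mul_pow,
          show (243 * n * Real.pi : ℝ) = (3 * 3) * (27 * n * Real.pi) by ring,
          ENNReal.ofReal_mul (p := 3 * 3) (by norm_num)]
        norm_num

lemma rpow_le_mul_exp {y a c : ℝ} (hy : 0 ≤ y) (ha : 0 < a) (hc : 0 < c) :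
    y ^ a ≤ (a / c) ^ a * Real.exp (c * y) := by
  have h1 : y = a / c * (c * y / a) := by field_simp
  have h2 : c * y / a ≤ Real.exp (c * y / a) := by
    linarith [Real.add_one_le_exp (c * y / a)]
  have h0 : 0 ≤ c * y / a := by positivity
  calc y ^ a = (a / c) ^ a * (c * y / a) ^ a := by
        rw [← Real.mul_rpow (by positivity) h0, ← h1]
    _ ≤ (a / c) ^ a * Real.exp (c * y / a) ^ a := by gcongr
    _ = _ := by
      rw [← Real.exp_mul]
      congr 2
      field_simp

lemma MemLexpPow.exists_lintegral_pow_le {α : ℝ} (hα : 0 < α) {f : ℝ → ℂ}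
    (hf : MemLexpPow α f) :
    ∃ K : ENNReal, K ≠ ⊤ ∧ ∃ C > (0 : ℝ), ∀ n : ℕ, 1 ≤ n →
      ∫⁻ x, ‖f x‖ₑ ^ (2 * n) ∂mIoo ≤ K * ENNReal.ofReal (C * (n : ℝ) ^ α) ^ (2 * n) := by
  obtain ⟨-, l, hl, hfin⟩ := hf
  refine ⟨_, hfin.ne, (2 * α / l) ^ α, by positivity, fun n hn => ?_⟩
  have hn0 : (0 : ℝ) < n := by exact_mod_cast hn
  rw [mul_comm (lintegral _ _), ← lintegral_const_mul' _ _ (by finiteness)]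
  refine lintegral_mono fun x => ?_
  rw [← ENNReal.ofReal_pow (by positivity), ← ENNReal.ofReal_mul (by positivity),
    ← ofReal_norm, ← ENNReal.ofReal_pow (norm_nonneg _)]
  refine ENNReal.ofReal_le_ofReal ?_
  have h := rpow_le_mul_exp (y := ‖f x‖ ^ (1 / α)) (a := α * (2 * n : ℕ)) (c := l) (by positivity)
    (by push_cast; positivity) hl
  have e1 : (‖f x‖ ^ (1 / α)) ^ (α * (2 * n : ℕ)) = ‖f x‖ ^ (2 * n) := by
    rw [← Real.rpow_mul (norm_nonneg _), ← mul_assoc, one_div_mul_cancel hα.ne', one_mul,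
      Real.rpow_natCast]
  have e2 : (α * (2 * n : ℕ) / l) ^ (α * (2 * n : ℕ)) =
      ((2 * α / l) ^ α * (n : ℝ) ^ α) ^ (2 * n) := by
    rw [Real.rpow_mul (by positivity), Real.rpow_natCast, ← Real.mul_rpow (by positivity)
      (by positivity)]
    congr 2
    push_cast; ring
  rwa [e1, e2] at h

lemma exp_le_tsum_pow {β δ s : ℝ} (hβ : 0 < β) (hδ : 0 < δ) (hs : 0 ≤ s) :
    ENNReal.ofReal (Real.exp (2 * (δ / Real.exp 1) ^ (1 / β) * s ^ (1 / β))) ≤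
      ENNReal.ofReal (Real.exp 2) *
        ∑' n : ℕ, ENNReal.ofReal (δ / (n : ℝ) ^ β) ^ (2 * n) * ENNReal.ofReal s ^ (2 * n) := by
  set y := (δ / Real.exp 1 * s) ^ (1 / β) with hy
  have hy0 : 0 ≤ y := by positivity
  have e1 : 2 * (δ / Real.exp 1) ^ (1 / β) * s ^ (1 / β) = 2 * y := by
    rw [hy, Real.mul_rpow (by positivity) hs]; ring
  rw [e1]
  refine le_trans ?_ (mul_le_mul_right (ENNReal.le_tsum ⌊y⌋₊) _)
  set N := ⌊y⌋₊ with hN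
  rw [← mul_pow, ← ENNReal.ofReal_mul (by positivity), ← ENNReal.ofReal_pow (by positivity),
    ← ENNReal.ofReal_mul (by positivity)]
  refine ENNReal.ofReal_le_ofReal ?_
  have hlt : y < N + 1 := Nat.lt_floor_add_one y
  have hexp : Real.exp (2 * y) ≤ Real.exp 2 * Real.exp 1 ^ (2 * N) := by
    rw [← Real.exp_nat_mul, ← Real.exp_add, Real.exp_le_exp]
    push_cast; linarith
  refine hexp.trans ?_
  rcases Nat.eq_zero_or_pos N with h0 | h0
  · rw [h0]; simp
  · have hNy : (N : ℝ) ≤ y := Nat.floor_le hy0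
    have hN0 : (0 : ℝ) < N := by exact_mod_cast h0
    gcongr
    have h1 : (N : ℝ) ^ β ≤ δ / Real.exp 1 * s := by
      calc (N : ℝ) ^ β ≤ y ^ β := by gcongr
        _ = _ := by
          rw [hy, ← Real.rpow_mul (by positivity), one_div_mul_cancel hβ.ne', Real.rpow_one]
    rw [div_mul_eq_mul_div, le_div_iff₀ (by positivity)]
    calc Real.exp 1 * (N : ℝ) ^ β ≤ Real.exp 1 * (δ / Real.exp 1 * s) := by gcongr
      _ = δ * s := by field_simp

lemma exists_lintegral_exp_le {β D : ℝ} (hβ : 0 < β) (hD : 0 < D) {K : ENNReal} (hK : K ≠ ⊤) :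
    ∃ μ > (0 : ℝ), ∃ K' : ENNReal, K' ≠ ⊤ ∧ ∀ h : ℝ → ℝ, Measurable h →
      (∀ n : ℕ, 1 ≤ n → ∫⁻ x, ‖h x‖ₑ ^ (2 * n) ∂mIoo ≤
        K * ENNReal.ofReal (D * (n : ℝ) ^ β) ^ (2 * n)) →
      ∫⁻ x, ENNReal.ofReal (Real.exp (μ * |h x| ^ (1 / β))) ∂mIoo ≤ K' := by
  set δ := (2 * D)⁻¹ with hδ
  have hδ0 : 0 < δ := by positivity
  refine ⟨2 * (δ / Real.exp 1) ^ (1 / β), by positivity,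
    ENNReal.ofReal (Real.exp 2) * ∑' n : ℕ, (K + mIoo Set.univ) * (2⁻¹ : ENNReal) ^ n, ?_, ?_⟩
  · rw [ENNReal.tsum_mul_left, ENNReal.tsum_geometric]
    have : mIoo Set.univ ≠ ⊤ := measure_ne_top _ _
    rw [ENNReal.one_sub_inv_two, inv_inv]
    finiteness
  intro h hm hbd
  calc ∫⁻ x, ENNReal.ofReal (Real.exp (2 * (δ / Real.exp 1) ^ (1 / β) * |h x| ^ (1 / β))) ∂mIoo
      ≤ ∫⁻ x, ENNReal.ofReal (Real.exp 2) *
        ∑' n : ℕ, ENNReal.ofReal (δ / (n : ℝ) ^ β) ^ (2 * n) * ‖h x‖ₑ ^ (2 * n) ∂mIoo := by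
        refine lintegral_mono fun x => ?_
        simp only [← ofReal_norm, Real.norm_eq_abs]
        exact exp_le_tsum_pow hβ hδ0 (abs_nonneg _)
    _ = ENNReal.ofReal (Real.exp 2) * ∑' n : ℕ, ENNReal.ofReal (δ / (n : ℝ) ^ β) ^ (2 * n) *
        ∫⁻ x, ‖h x‖ₑ ^ (2 * n) ∂mIoo := by
        rw [lintegral_const_mul' _ _ (by finiteness), lintegral_tsum (fun n => by fun_prop)]
        congr 2
        funext n
        rw [lintegral_const_mul' _ _ (by finiteness)]
    _ ≤ _ := by
        refine mul_le_mul_right (ENNReal.tsum_le_tsum fun n => ?_) _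
        rcases Nat.eq_zero_or_pos n with rfl | hn
        · simp
        · have hn0 : (0 : ℝ) < n := by exact_mod_cast hn
          calc _ ≤ ENNReal.ofReal (δ / (n : ℝ) ^ β) ^ (2 * n) *
                (K * ENNReal.ofReal (D * (n : ℝ) ^ β) ^ (2 * n)) := by
                gcongr; exact hbd n hn
            _ = K * (2⁻¹ : ENNReal) ^ (2 * n) := by
                rw [mul_left_comm, ← mul_pow, ← ENNReal.ofReal_mul (by positivity)]
                congr 2
                have : δ / (n : ℝ) ^ β * (D * (n : ℝ) ^ β) = 2⁻¹ := by
                  rw [hδ]; field_simp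
                rw [this, ENNReal.ofReal_inv_of_pos (by norm_num)]
                norm_num
            _ ≤ _ := by
                refine mul_le_mul' le_self_add ?_
                exact pow_le_pow_right_of_le_one' (by simp) (by omega)

/-- Uniform exponential integrability of the majorants of the truncated Hilbert transforms. -/
lemma MemLexpPow.exists_lintegral_exp_hilbertMaj_le {α : ℝ} (hα : 0 < α) {f : ℝ → ℂ}
    (hf : MemLexpPow α f) (hfi : Integrable f mIoo) :
    ∃ μ > (0 : ℝ), ∃ K : ENNReal, K ≠ ⊤ ∧ ∀ ε > (0 : ℝ),
      ∫⁻ t, ENNReal.ofReal (Real.exp (μ * |hilbertMaj f ε t| ^ (1 / (α + 1)))) ∂mIoo ≤ K := by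
  obtain ⟨K, hK, C, hC, hbd⟩ := hf.exists_lintegral_pow_le hα
  obtain ⟨μ, hμ, K', hK', hexp⟩ := exists_lintegral_exp_le (β := α + 1) (D := 243 * Real.pi * C)
    (by linarith) (by positivity) hK
  refine ⟨μ, hμ, K', hK', fun ε hε => hexp _ (continuous_hilbertMaj hfi hε).measurable ?_⟩
  intro n hn
  have hn0 : (0 : ℝ) < n := by exact_mod_cast hn
  refine (lintegral_hilbertMaj_pow_le hfi hε hn).trans ?_
  calc _ ≤ ENNReal.ofReal (243 * n * Real.pi) ^ (2 * n) *
        (K * ENNReal.ofReal (C * (n : ℝ) ^ α) ^ (2 * n)) := by gcongr; exact hbd n hn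
    _ = _ := by
      rw [mul_left_comm, ← mul_pow, ← ENNReal.ofReal_mul (by positivity)]
      congr 3
      rw [Real.rpow_add_one hn0.ne']
      ring

lemma w_pos {x : ℝ} (hx : x ∈ Set.Ioo (-1 : ℝ) 1) : 0 < w x :=
  Real.sqrt_pos.2 (by nlinarith [hx.1, hx.2])

lemma w_le_one (x : ℝ) : w x ≤ 1 := Real.sqrt_le_one.2 (by nlinarith [sq_nonneg x])

lemma measurable_w : Measurable w := by unfold w; fun_prop

lemma ae_mem_Ioo_mIoo : ∀ᵐ x ∂mIoo, x ∈ Set.Ioo (-1 : ℝ) 1 := ae_restrict_mem measurableSet_Ioo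

lemma w_rpow_le {a x : ℝ} (ha1 : a ≤ 1) (hx : x ∈ Set.Ioo (-1 : ℝ) 1) :
    w x ^ (-2 + a) ≤ (1 - x) ^ (a / 2 - 1) + (1 + x) ^ (a / 2 - 1) := by
  have h1 : 0 < 1 - x := by linarith [hx.2]
  have h2 : 0 < 1 + x := by linarith [hx.1]
  have hs : a / 2 - 1 ≤ 0 := by linarith
  have hw : w x ^ (-2 + a) = (1 - x ^ 2) ^ (a / 2 - 1) := by
    rw [w, Real.sqrt_eq_rpow, ← Real.rpow_mul (by nlinarith)]
    congr 1; ring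
  rw [hw]
  rcases le_total 0 x with h | h
  · refine (Real.rpow_le_rpow_of_nonpos h1 (by nlinarith) hs).trans ?_
    have : 0 ≤ (1 + x) ^ (a / 2 - 1) := by positivity
    linarith
  · refine (Real.rpow_le_rpow_of_nonpos h2 (by nlinarith) hs).trans ?_
    have : 0 ≤ (1 - x) ^ (a / 2 - 1) := by positivity
    linarith

lemma integrable_w_rpow {a : ℝ} (ha : 0 < a) (ha1 : a ≤ 1) :
    Integrable (fun x => w x ^ (-2 + a)) mIoo ∧ ∫ x, w x ^ (-2 + a) ∂mIoo ≤ 8 / a := by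
  have hr : -1 < a / 2 - 1 := by linarith
  have hmeas : mIoo = volume.restrict (Set.Ioc (-1 : ℝ) 1) := by
    unfold mIoo; exact Measure.restrict_congr_set Ioo_ae_eq_Ioc
  have hI0 : IntervalIntegrable (fun x : ℝ => x ^ (a / 2 - 1)) volume 0 2 :=
    intervalIntegral.intervalIntegrable_rpow' hr
  have hI1 : IntervalIntegrable (fun x : ℝ => (1 - x) ^ (a / 2 - 1)) volume (-1) 1 := by
    have := hI0.comp_sub_left 1
    norm_num at this
    exact this.symm
  have hI2 : IntervalIntegrable (fun x : ℝ => (1 + x) ^ (a / 2 - 1)) volume (-1) 1 := by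
    have := hI0.comp_add_left 1
    norm_num at this
    exact this
  have hI02 : ∫ x in (0 : ℝ)..2, x ^ (a / 2 - 1) ≤ 4 / a := by
    rw [integral_rpow (Or.inl hr)]
    have h0 : (0 : ℝ) ^ (a / 2 - 1 + 1) = 0 := Real.zero_rpow (by linarith)
    have h2 : (2 : ℝ) ^ (a / 2 - 1 + 1) ≤ 2 ^ (1 : ℝ) :=
      Real.rpow_le_rpow_of_exponent_le (by norm_num) (by linarith)
    rw [Real.rpow_one] at h2
    rw [h0, sub_zero, div_le_div_iff₀ (by linarith) ha]
    nlinarith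
  have hs1 : ∫ x in (-1 : ℝ)..1, (1 - x) ^ (a / 2 - 1) ≤ 4 / a := by
    rw [intervalIntegral.integral_comp_sub_left (fun x : ℝ => x ^ (a / 2 - 1)) 1]
    norm_num
    exact hI02
  have hs2 : ∫ x in (-1 : ℝ)..1, (1 + x) ^ (a / 2 - 1) ≤ 4 / a := by
    rw [intervalIntegral.integral_comp_add_left (fun x : ℝ => x ^ (a / 2 - 1)) 1]
    norm_num
    exact hI02
  rw [intervalIntegrable_iff_integrableOn_Ioc_of_le (by norm_num)] at hI1 hI2
  rw [intervalIntegral.integral_of_le (by norm_num), ← hmeas] at hs1 hs2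
  unfold IntegrableOn at hI1 hI2
  rw [← hmeas] at hI1 hI2
  have hle : ∀ᵐ x ∂mIoo, w x ^ (-2 + a) ≤ (1 - x) ^ (a / 2 - 1) + (1 + x) ^ (a / 2 - 1) := by
    filter_upwards [ae_mem_Ioo_mIoo] with x hx using w_rpow_le ha1 hx
  have hwI : Integrable (fun x => w x ^ (-2 + a)) mIoo := by
    refine (hI1.add hI2).mono' (measurable_w.pow_const _).aestronglyMeasurable ?_
    filter_upwards [hle] with x hx
    have h0 : 0 ≤ w x := Real.sqrt_nonneg _
    rw [Real.norm_of_nonneg (Real.rpow_nonneg h0 _)]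
    exact hx
  refine ⟨hwI, (integral_mono_ae hwI (hI1.add hI2) hle).trans ?_⟩
  rw [integral_add' hI1 hI2]
  calc _ ≤ 4 / a + 4 / a := add_le_add hs1 hs2
    _ = _ := by ring

/-- An exponentially integrable function stays integrable, with a smaller exponent, when divided
by the weight. -/
lemma integrable_exp_div_w {E : ℝ → ℝ} (hE : AEStronglyMeasurable E mIoo)
    (hfin : ∫⁻ x, ENNReal.ofReal (Real.exp (E x)) ∂mIoo < ⊤) :
    Integrable (fun x => Real.exp (E x / 4) / w x) mIoo := by
  have hexp : Integrable (fun x => Real.exp (E x)) mIoo := by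
    refine ⟨Real.continuous_exp.comp_aestronglyMeasurable hE, ?_⟩
    rw [hasFiniteIntegral_iff_ofReal (Eventually.of_forall fun x => (Real.exp_pos _).le)]
    exact hfin
  have hw := (integrable_w_rpow (a := 2 / 3) (by norm_num) (by norm_num)).1
  refine (hexp.add hw).mono' ?_ ?_
  · refine (AEMeasurable.div ?_ measurable_w.aemeasurable).aestronglyMeasurable
    exact Real.measurable_exp.comp_aemeasurable (hE.aemeasurable.div_const _)
  · filter_upwards [ae_mem_Ioo_mIoo] with x hx
    have hw0 := w_pos hx
    have hA0 : 0 < Real.exp (E x / 4) := Real.exp_pos _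
    have hA : Real.exp (E x) = Real.exp (E x / 4) ^ (4 : ℕ) := by
      rw [← Real.exp_nat_mul]; congr 1; push_cast; ring
    set A := Real.exp (E x / 4)
    set b := (w x) ^ (-(1 / 3) : ℝ) with hb
    have hb0 : 0 < b := by positivity
    have h1 : (w x)⁻¹ = b ^ 3 := by
      rw [hb, ← Real.rpow_natCast, ← Real.rpow_mul hw0.le, ← Real.rpow_neg_one]
      norm_num
    have h2 : w x ^ (-2 + 2 / 3 : ℝ) = b ^ 4 := by
      rw [hb, ← Real.rpow_natCast, ← Real.rpow_mul hw0.le]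
      norm_num
    rw [Real.norm_of_nonneg (by positivity), Pi.add_apply, h2, div_eq_mul_inv, h1, hA]
    rcases le_total A b with h | h
    · have : A * b ^ 3 ≤ b * b ^ 3 := by gcongr
      have : 0 < A ^ 4 := by positivity
      nlinarith
    · have : A * b ^ 3 ≤ A * A ^ 3 := by gcongr
      have : 0 < b ^ 4 := by positivity
      nlinarith

lemma MemLexpPow.integrable_div_w {α : ℝ} (hα : 0 < α) {f : ℝ → ℂ} (hf : MemLexpPow α f) :
    Integrable (fun x => ‖f x‖ / w x) mIoo := by
  obtain ⟨hm, l, hl, hfin⟩ := hf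
  have hE := integrable_exp_div_w (E := fun x => l * ‖f x‖ ^ (1 / α))
    ((hm.norm.aemeasurable.pow_const _).const_mul _).aestronglyMeasurable hfin
  refine (hE.const_mul ((α / (l / 4)) ^ α)).mono'
    (hm.norm.aemeasurable.div measurable_w.aemeasurable).aestronglyMeasurable ?_
  filter_upwards [ae_mem_Ioo_mIoo] with x hx
  have hw0 := w_pos hx
  rw [Real.norm_of_nonneg (by positivity), ← mul_div_assoc]
  gcongr
  have h := rpow_le_mul_exp (y := ‖f x‖ ^ (1 / α)) (a := α) (c := l / 4) (by positivity) hα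
    (by positivity)
  rw [← Real.rpow_mul (norm_nonneg _), one_div_mul_cancel hα.ne', Real.rpow_one] at h
  have e : l * ‖f x‖ ^ (1 / α) / 4 = l / 4 * ‖f x‖ ^ (1 / α) := by ring
  rw [e]
  exact h

lemma MemLexpPow.integrable {α : ℝ} (hα : 0 < α) {f : ℝ → ℂ} (hf : MemLexpPow α f) :
    Integrable f mIoo := by
  refine (hf.integrable_div_w hα).mono' hf.1 ?_
  filter_upwards [ae_mem_Ioo_mIoo] with x hx
  rw [le_div_iff₀ (w_pos hx)]
  nlinarith [norm_nonneg (f x), w_le_one x]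

lemma inv_w_mul_add_le {x v : ℝ} (hx : x ∈ Set.Ioo (-1 : ℝ) 1) (hv : 0 < v) (hv1 : v ≤ 1) :
    (w x * (w x + v))⁻¹ ≤ Real.exp 1 * w x ^ (-2 + (1 - Real.log v)⁻¹) := by
  have hw0 := w_pos hx
  have hlog : Real.log v ≤ 0 := Real.log_nonpos hv.le hv1
  set Λ := 1 - Real.log v with hΛ
  have hΛ1 : 1 ≤ Λ := by linarith
  have ha0 : 0 < Λ⁻¹ := by positivity
  have ha1 : Λ⁻¹ ≤ 1 := inv_le_one_of_one_le₀ hΛ1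
  have hgm := Real.geom_mean_le_arith_mean2_weighted (w₁ := 1 - Λ⁻¹) (w₂ := Λ⁻¹) (p₁ := w x)
    (p₂ := v) (by linarith) ha0.le hw0.le hv.le (by ring)
  have hgm' : w x ^ (1 - Λ⁻¹) * v ^ Λ⁻¹ ≤ w x + v := by nlinarith
  have hve : Real.exp (-1) ≤ v ^ Λ⁻¹ := by
    rw [Real.rpow_def_of_pos hv, Real.exp_le_exp]
    have : Real.log v = 1 - Λ := by rw [hΛ]; ring
    rw [this, sub_mul, one_mul, mul_inv_cancel₀ (by linarith)]
    linarith
  have hpos : 0 < w x ^ (1 - Λ⁻¹) := by positivity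
  rw [inv_le_iff_one_le_mul₀ (by positivity)]
  have e : w x ^ (-2 + Λ⁻¹) * (w x * w x ^ (1 - Λ⁻¹)) = 1 := by
    rw [← Real.rpow_one_add' hw0.le (by linarith), ← Real.rpow_add hw0]
    convert Real.rpow_zero (w x) using 2
    ring
  calc (1 : ℝ) = Real.exp 1 * w x ^ (-2 + Λ⁻¹) * (w x * (w x ^ (1 - Λ⁻¹) * Real.exp (-1))) := by
        have hee : Real.exp 1 * Real.exp (-1) = 1 := by rw [← Real.exp_add]; simp
        calc (1 : ℝ) = Real.exp 1 * Real.exp (-1) *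
              (w x ^ (-2 + Λ⁻¹) * (w x * w x ^ (1 - Λ⁻¹))) := by rw [hee, e, one_mul]
          _ = _ := by ring
    _ ≤ Real.exp 1 * w x ^ (-2 + Λ⁻¹) * (w x * (w x ^ (1 - Λ⁻¹) * v ^ Λ⁻¹)) := by gcongr
    _ ≤ _ := by gcongr

/-- Logarithmic bound for the Stieltjes-type operator comparing the weighted and the unweighted
Hilbert transforms. -/
lemma MemLexpPow.exists_stieltjes_le {α : ℝ} (hα : 0 < α) {f : ℝ → ℂ} (hf : MemLexpPow α f) :
    ∃ C > (0 : ℝ), ∀ t ∈ Set.Ioo (-1 : ℝ) 1,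
      Integrable (fun x => ‖f x‖ * (w x * (w x + w t))⁻¹) mIoo ∧
      ∫ x, ‖f x‖ * (w x * (w x + w t))⁻¹ ∂mIoo ≤ C * (1 - Real.log (w t)) ^ (α + 1) := by
  have hfw := hf.integrable_div_w hα
  obtain ⟨hm, l, hl, hfin⟩ := hf
  have hE := integrable_exp_div_w (E := fun x => l * ‖f x‖ ^ (1 / α))
    ((hm.norm.aemeasurable.pow_const _).const_mul _).aestronglyMeasurable hfin
  set J := ∫ x, Real.exp (l * ‖f x‖ ^ (1 / α) / 4) / w x ∂mIoo with hJ
  have hJ0 : 0 ≤ J := by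
    refine integral_nonneg fun x => ?_
    have : 0 ≤ w x := Real.sqrt_nonneg _
    exact div_nonneg (Real.exp_pos _).le this
  refine ⟨(l ^ α)⁻¹ * (8 ^ α * Real.exp 1 * 8 + (8 * α) ^ α * J), by positivity, fun t ht => ?_⟩
  have hv := w_pos ht
  have hv1 := w_le_one t
  set v := w t
  have hlog : Real.log v ≤ 0 := Real.log_nonpos hv.le hv1
  have hinv := fun x hx => inv_w_mul_add_le (x := x) hx hv hv1
  have hve : Real.exp (-(1 - Real.log v)) ≤ v := by
    rw [neg_sub, Real.exp_sub, Real.exp_log hv]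
    exact div_le_self hv.le (Real.one_le_exp (by norm_num))
  set Λ := 1 - Real.log v with hΛ
  have hΛ1 : 1 ≤ Λ := by linarith
  obtain ⟨hwi, hwb⟩ := integrable_w_rpow (a := Λ⁻¹) (by positivity) (inv_le_one_of_one_le₀ hΛ1)
  have hI : Integrable (fun x => ‖f x‖ * (w x * (w x + v))⁻¹) mIoo := by
    refine (hfw.mul_const v⁻¹).mono' ?_ ?_
    · exact (hm.norm.aemeasurable.mul ((measurable_w.mul (measurable_w.add_const v)).inv).aemeasurable
        ).aestronglyMeasurable
    · filter_upwards [ae_mem_Ioo_mIoo] with x hx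
      have hw0 := w_pos hx
      rw [Real.norm_of_nonneg (by positivity), mul_inv, div_eq_mul_inv, mul_assoc]
      gcongr
      linarith
  refine ⟨hI, ?_⟩
  have hptw : ∀ᵐ x ∂mIoo, ‖f x‖ * (w x * (w x + v))⁻¹ ≤
      (l ^ α)⁻¹ * ((8 * Λ) ^ α * Real.exp 1 * w x ^ (-2 + Λ⁻¹) +
        (8 * α) ^ α * (Real.exp (l * ‖f x‖ ^ (1 / α) / 4) / w x)) := by
    filter_upwards [ae_mem_Ioo_mIoo] with x hx
    have hw0 := w_pos hx
    set y := l * ‖f x‖ ^ (1 / α) with hy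
    have hy0 : 0 ≤ y := by positivity
    have hfy : ‖f x‖ = (l ^ α)⁻¹ * y ^ α := by
      rw [hy, Real.mul_rpow hl.le (by positivity), ← Real.rpow_mul (norm_nonneg _),
        one_div_mul_cancel hα.ne', Real.rpow_one]
      field_simp
    rw [hfy, mul_assoc]
    gcongr
    rcases le_total y (8 * Λ) with h | h
    · calc y ^ α * (w x * (w x + v))⁻¹ ≤ (8 * Λ) ^ α * (Real.exp 1 * w x ^ (-2 + Λ⁻¹)) := by
            gcongr; exact hinv x hx
        _ = (8 * Λ) ^ α * Real.exp 1 * w x ^ (-2 + Λ⁻¹) := by ring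
        _ ≤ _ := by
          have : 0 ≤ (8 * α) ^ α * (Real.exp (y / 4) / w x) := by positivity
          linarith
    · have h1 := rpow_le_mul_exp (c := 1 / 8) hy0 hα (by norm_num)
      have h2 : Real.exp (1 / 8 * y) ≤ Real.exp (y / 4) * v := by
        calc _ ≤ Real.exp (y / 4 + -Λ) := Real.exp_le_exp.2 (by linarith)
          _ ≤ _ := by rw [Real.exp_add]; gcongr
      have h3 : y ^ α ≤ (8 * α) ^ α * (Real.exp (y / 4) * v) := by
        refine h1.trans ?_
        rw [show α / (1 / 8) = 8 * α by ring]
        gcongr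
      calc y ^ α * (w x * (w x + v))⁻¹
          ≤ (8 * α) ^ α * (Real.exp (y / 4) * v) * (w x * v)⁻¹ := by
            gcongr; linarith
        _ = (8 * α) ^ α * (Real.exp (y / 4) / w x) := by field_simp
        _ ≤ _ := by
          have : 0 ≤ (8 * Λ) ^ α * Real.exp 1 * w x ^ (-2 + Λ⁻¹) := by positivity
          linarith
  refine (integral_mono_ae hI (((hwi.const_mul _).add (hE.const_mul _)).const_mul _) hptw).trans ?_
  rw [integral_const_mul, integral_add' (hwi.const_mul _) (hE.const_mul _), integral_const_mul,
    integral_const_mul, ← hJ, mul_assoc (l ^ α)⁻¹]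
  refine mul_le_mul_of_nonneg_left ?_ (by positivity)
  rw [div_inv_eq_mul] at hwb
  have hL : 1 ≤ Λ ^ (α + 1) := Real.one_le_rpow hΛ1 (by linarith)
  have hL' : Λ ^ (α + 1) = Λ ^ α * Λ := Real.rpow_add_one (by linarith) _
  calc _ ≤ (8 * Λ) ^ α * Real.exp 1 * (8 * Λ) + (8 * α) ^ α * J * Λ ^ (α + 1) := by
        exact add_le_add (mul_le_mul_of_nonneg_left hwb (by positivity))
          (le_mul_of_one_le_right (by positivity) hL)
    _ = _ := by
        rw [Real.mul_rpow (by norm_num) (by linarith), hL']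
        ring

lemma lintegral_exp_log_w_lt_top :
    ∫⁻ t, ENNReal.ofReal (Real.exp (1 - Real.log (w t))) ∂mIoo < ⊤ := by
  have h := ((integrable_w_rpow (a := 1) one_pos le_rfl).1.const_mul (Real.exp 1))
  refine lt_of_le_of_lt (lintegral_mono_ae ?_) h.lintegral_lt_top
  filter_upwards [ae_mem_Ioo_mIoo] with x hx
  rw [Real.exp_sub, Real.exp_log (w_pos hx), show (-2 + 1 : ℝ) = -1 by norm_num, Real.rpow_neg_one,
    div_eq_mul_inv]

lemma measurable_truncKer_sub (ε t : ℝ) : Measurable fun x : ℝ => (truncKer ε (x - t) : ℂ) :=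
  Complex.measurable_ofReal.comp
    (measurable_truncKer.comp (by fun_prop : Measurable fun x : ℝ => (ε, x - t)))

lemma integrable_mul_truncKer {g : ℝ → ℂ} (hg : Integrable g mIoo) {ε : ℝ} (hε : 0 < ε) (t : ℝ) :
    Integrable (fun x => g x * (truncKer ε (x - t) : ℂ)) mIoo := by
  refine integrable_mul_of_le hg (measurable_truncKer_sub ε t) (C := ε⁻¹) fun x => ?_
  rw [Complex.norm_real]
  exact abs_truncKer_le hε _

lemma setIntegral_add_setIntegral_eq_truncInt {g : ℝ → ℂ} (hg : Integrable g mIoo) {ε t : ℝ}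
    (hε : 0 < ε) (ht : t ∈ Set.Ioo (-1 : ℝ) 1) :
    (∫ x in Set.Ioo (-1 : ℝ) (t - ε), g x / (↑x - ↑t)) +
      ∫ x in Set.Ioo (t + ε) (1 : ℝ), g x / (↑x - ↑t) = truncInt g ε t := by
  have hT := integrable_mul_truncKer hg hε t
  have hkey : ∀ x, ε < |x - t| → g x / ((x : ℂ) - t) = g x * (truncKer ε (x - t) : ℂ) := by
    intro x hx
    simp [truncKer, hx, div_eq_mul_inv]
  have hl : ∀ x ∈ Set.Ioo (-1 : ℝ) (t - ε),
      g x / ((x : ℂ) - t) = g x * (truncKer ε (x - t) : ℂ) := fun x hx =>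
    hkey x (lt_of_lt_of_le (by linarith [hx.2]) (neg_le_abs _))
  have hr : ∀ x ∈ Set.Ioo (t + ε) (1 : ℝ),
      g x / ((x : ℂ) - t) = g x * (truncKer ε (x - t) : ℂ) := fun x hx =>
    hkey x (lt_of_lt_of_le (by linarith [hx.1]) (le_abs_self _))
  have hsubl : Set.Ioo (-1 : ℝ) (t - ε) ⊆ Set.Ioo (-1 : ℝ) 1 :=
    Set.Ioo_subset_Ioo_right (by linarith [ht.2])
  have hsubr : Set.Ioo (t + ε) (1 : ℝ) ⊆ Set.Ioo (-1 : ℝ) 1 :=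
    Set.Ioo_subset_Ioo_left (by linarith [ht.1])
  have hT' : IntegrableOn (fun x => g x * (truncKer ε (x - t) : ℂ)) (Set.Ioo (-1 : ℝ) 1) := hT
  rw [setIntegral_congr_fun measurableSet_Ioo hl, setIntegral_congr_fun measurableSet_Ioo hr,
    ← setIntegral_union _ measurableSet_Ioo (hT'.mono_set hsubl) (hT'.mono_set hsubr)]
  · refine (setIntegral_eq_of_subset_of_forall_sdiff_eq_zero measurableSet_Ioo
      (Set.union_subset hsubl hsubr) fun x hx => ?_).symm
    have hnot : ¬ ε < |x - t| := by
      intro h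
      rcases lt_abs.1 h with h | h
      · exact hx.2 (Or.inr ⟨by linarith, hx.1.2⟩)
      · exact hx.2 (Or.inl ⟨hx.1.1, by linarith⟩)
    simp [truncKer, hnot]
  · rw [Set.disjoint_left]
    intro x hx hx'
    linarith [hx.2, hx'.1]

lemma w_mul_norm_truncInt_le {f : ℝ → ℂ} (hf : Integrable f mIoo)
    (hfw : Integrable (fun x => f x / (w x : ℂ)) mIoo) {ε t : ℝ} (hε : 0 < ε)
    (ht : t ∈ Set.Ioo (-1 : ℝ) 1)
    (hS : Integrable (fun x => ‖f x‖ * (w x * (w x + w t))⁻¹) mIoo) :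
    w t * ‖truncInt (fun x => f x / (w x : ℂ)) ε t‖ ≤
      hilbertMaj f ε t + 2 * ∫ x, ‖f x‖ * (w x * (w x + w t))⁻¹ ∂mIoo := by
  have hv := w_pos ht
  have hdiff : ‖(w t : ℂ) * truncInt (fun x => f x / (w x : ℂ)) ε t - truncInt f ε t‖ ≤
      ∫ x, 2 * (‖f x‖ * (w x * (w x + w t))⁻¹) ∂mIoo := by
    unfold truncInt
    rw [← integral_const_mul, ← integral_sub ((integrable_mul_truncKer hfw hε t).const_mul _)
      (integrable_mul_truncKer hf hε t)]
    refine norm_integral_le_of_norm_le (hS.const_mul 2) ?_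
    filter_upwards [ae_mem_Ioo_mIoo] with x hx
    have hw0 := w_pos hx
    have hwx : (w x : ℂ) ≠ 0 := by exact_mod_cast hw0.ne'
    have e : (w t : ℂ) * (f x / w x * truncKer ε (x - t)) - f x * truncKer ε (x - t) =
        f x * (((truncKer ε (x - t) * (w t - w x) / w x : ℝ)) : ℂ) := by
      push_cast
      field_simp
    have hsq : (w t - w x) * (w t + w x) = (x - t) * (x + t) := by
      have h1 : w t ^ 2 = 1 - t ^ 2 := Real.sq_sqrt (by nlinarith [ht.1, ht.2])
      have h2 : w x ^ 2 = 1 - x ^ 2 := Real.sq_sqrt (by nlinarith [hx.1, hx.2])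
      linear_combination h1 - h2
    have hk : |truncKer ε (x - t) * (w t - w x)| ≤ 2 / (w x + w t) := by
      unfold truncKer
      split_ifs with h
      · have h0 : x - t ≠ 0 := abs_pos.1 (hε.trans h)
        have e2 : (x - t)⁻¹ * (w t - w x) = (x + t) / (w x + w t) := by
          rw [eq_div_iff (by positivity), inv_mul_eq_div, div_mul_eq_mul_div, div_eq_iff h0]
          linear_combination hsq
        rw [e2, abs_div, abs_of_pos (by positivity : 0 < w x + w t)]
        gcongr
        rw [abs_le]
        constructor <;> linarith [hx.1, hx.2, ht.1, ht.2]
      · rw [zero_mul, abs_zero]; positivity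
    rw [e, norm_mul, Complex.norm_real, Real.norm_eq_abs, abs_div, abs_of_pos hw0]
    calc ‖f x‖ * (|truncKer ε (x - t) * (w t - w x)| / w x)
        ≤ ‖f x‖ * (2 / (w x + w t) / w x) := by gcongr
      _ = _ := by field_simp
  rw [integral_const_mul] at hdiff
  have h1 := norm_truncInt_le hf hε t
  have h2 : ‖(w t : ℂ) * truncInt (fun x => f x / (w x : ℂ)) ε t‖ =
      w t * ‖truncInt (fun x => f x / (w x : ℂ)) ε t‖ := by
    rw [norm_mul, Complex.norm_real, Real.norm_of_nonneg hv.le]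
  rw [← h2]
  have h3 := norm_sub_norm_le ((w t : ℂ) * truncInt (fun x => f x / (w x : ℂ)) ε t) (truncInt f ε t)
  linarith

lemma FHT_eq_limUnder_truncInt {g : ℝ → ℂ} (hg : Integrable g mIoo) {t : ℝ}
    (ht : t ∈ Set.Ioo (-1 : ℝ) 1) :
    FHT g t = limUnder (nhdsWithin (0 : ℝ) (Set.Ioi 0)) fun ε =>
      (Real.pi : ℂ)⁻¹ * truncInt g ε t := by
  unfold FHT limUnder
  congr 1
  refine Filter.map_congr ?_
  filter_upwards [self_mem_nhdsWithin] with ε hε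
  rw [setIntegral_add_setIntegral_eq_truncInt hg hε ht]

/-- The filter of positive rationals tending to `0`. -/
def ratNhdsGT : Filter ℚ := comap (fun q : ℚ => (q : ℝ)) (nhdsWithin (0 : ℝ) (Set.Ioi 0))

instance : ratNhdsGT.NeBot := by
  refine comap_neBot_iff.2 fun s hs => ?_
  obtain ⟨δ, hδ, hsub⟩ := mem_nhdsGT_iff_exists_Ioo_subset.1 hs
  obtain ⟨q, hq⟩ := exists_rat_btwn (show (0 : ℝ) < δ from hδ)
  exact ⟨q, hsub hq⟩

instance : ratNhdsGT.IsCountablyGenerated := by unfold ratNhdsGT; infer_instance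

lemma tendsto_nhdsGT_of_tendsto_rat {E : Type*} [TopologicalSpace E] [RegularSpace E] {φ : ℝ → E}
    (hφ : ∀ ε > 0, ContinuousWithinAt φ (Set.Ioi ε) ε) {c : E}
    (h : Tendsto (fun q : ℚ => φ q) ratNhdsGT (nhds c)) :
    Tendsto φ (nhdsWithin (0 : ℝ) (Set.Ioi 0)) (nhds c) := by
  rw [(closed_nhds_basis c).tendsto_right_iff]
  rintro s ⟨hs, hcl⟩
  obtain ⟨U, hU, hsub⟩ := mem_comap.1 (h hs)
  obtain ⟨δ, hδ, hδU⟩ := mem_nhdsGT_iff_exists_Ioo_subset.1 hU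
  filter_upwards [Ioo_mem_nhdsGT hδ] with ε hε
  by_contra hns
  have hev := (hφ ε hε.1).eventually (hcl.isOpen_compl.mem_nhds hns)
  obtain ⟨ε', hε', hsub'⟩ := mem_nhdsGT_iff_exists_Ioo_subset.1 hev
  obtain ⟨q, hq1, hq2⟩ := exists_rat_btwn (lt_min hε' hε.2)
  have h1 : (q : ℝ) ∈ Set.Ioo ε ε' := ⟨hq1, hq2.trans_le (min_le_left _ _)⟩
  have h2 : (q : ℝ) ∈ Set.Ioo 0 δ := ⟨hε.1.trans hq1, hq2.trans_le (min_le_right _ _)⟩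
  exact hsub' h1 (hsub (hδU h2))

lemma limUnder_nhdsGT_eq_rat {E : Type*} [TopologicalSpace E] [T3Space E] [Nonempty E] {φ : ℝ → E}
    (hφ : ∀ ε > 0, ContinuousWithinAt φ (Set.Ioi ε) ε) :
    limUnder (nhdsWithin (0 : ℝ) (Set.Ioi 0)) φ = limUnder ratNhdsGT (fun q : ℚ => φ q) := by
  by_cases h : ∃ c, Tendsto φ (nhdsWithin (0 : ℝ) (Set.Ioi 0)) (nhds c)
  · obtain ⟨c, hc⟩ := h
    have hr : Tendsto (fun q : ℚ => φ q) ratNhdsGT (nhds c) := hc.comp tendsto_comap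
    rw [hc.limUnder_eq, hr.limUnder_eq]
  · rw [limUnder_of_not_tendsto h, limUnder_of_not_tendsto]
    rintro ⟨c, hc⟩
    exact h ⟨c, tendsto_nhdsGT_of_tendsto_rat hφ hc⟩

lemma continuousWithinAt_truncInt {g : ℝ → ℂ} (hg : Integrable g mIoo) (t : ℝ) {ε : ℝ}
    (hε : 0 < ε) : ContinuousWithinAt (fun δ => truncInt g δ t) (Set.Ioi ε) ε := by
  unfold truncInt
  refine tendsto_integral_filter_of_dominated_convergence (fun x => ‖g x‖ * ε⁻¹) ?_ ?_
    (hg.norm.mul_const _) ?_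
  · filter_upwards [self_mem_nhdsWithin] with δ hδ
    exact (integrable_mul_truncKer hg (hε.trans hδ) t).1
  · filter_upwards [self_mem_nhdsWithin] with δ hδ
    refine Eventually.of_forall fun x => ?_
    rw [norm_mul, Complex.norm_real]
    gcongr
    refine (abs_truncKer_le (hε.trans hδ) _).trans ?_
    have : ε < δ := hδ
    gcongr
  · refine Eventually.of_forall fun x => ?_
    refine tendsto_const_nhds.congr' ?_
    by_cases h : ε < |x - t|
    · filter_upwards [Ioo_mem_nhdsGT h] with δ hδ
      simp [truncKer, h, hδ.2]
    · filter_upwards [self_mem_nhdsWithin] with δ hδ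
      have h' : ¬ δ < |x - t| := fun h2 => h (lt_trans hδ h2)
      simp [truncKer, h, h']

lemma aestronglyMeasurable_FHT {g : ℝ → ℂ} (hg : Integrable g mIoo) :
    AEStronglyMeasurable (FHT g) mIoo := by
  set g₀ := hg.1.mk g
  have hg₀ : StronglyMeasurable g₀ := hg.1.stronglyMeasurable_mk
  have hm : StronglyMeasurable fun t =>
      limUnder ratNhdsGT fun q : ℚ => (Real.pi : ℂ)⁻¹ * truncInt g₀ q t := by
    refine StronglyMeasurable.limUnder fun q => StronglyMeasurable.const_mul ?_ _
    refine StronglyMeasurable.integral_prod_right (Measurable.stronglyMeasurable ?_)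
    exact (hg₀.measurable.comp measurable_snd).mul (Complex.measurable_ofReal.comp
      (measurable_truncKer.comp (by fun_prop : Measurable fun p : ℝ × ℝ => ((q : ℝ), p.2 - p.1))))
  refine ⟨_, hm, ?_⟩
  filter_upwards [ae_mem_Ioo_mIoo] with t ht
  have htr : ∀ ε, truncInt g₀ ε t = truncInt g ε t := fun ε =>
    integral_congr_ae (by filter_upwards [hg.1.ae_eq_mk] with x hx; rw [hx])
  rw [FHT_eq_limUnder_truncInt hg ht, limUnder_nhdsGT_eq_rat fun ε hε =>
    (continuousWithinAt_truncInt hg t hε).const_mul _]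
  simp only [htr]

lemma exp_mul_rpow_le {q μ ν C : ℝ} (hq : 0 < q) (hq1 : q ≤ 1) (hμ : 0 < μ) (hC : 0 < C)
    (hν : 0 < ν) (hνμ : ν ≤ μ / 2) (hνC : ν * (4 * C) ^ q ≤ 1) {X a Λ : ℝ} (hX : 0 ≤ X)
    (ha : 0 ≤ a) (hΛ : 0 ≤ Λ) (h : X ≤ a + 2 * (C * Λ ^ q⁻¹)) :
    Real.exp (ν * X ^ q) ≤ Real.exp (μ * a ^ q) + Real.exp Λ := by
  have hb : 0 ≤ Λ ^ q⁻¹ := by positivity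
  rcases le_total a (2 * (C * Λ ^ q⁻¹)) with h1 | h1
  · have h2 : X ^ q ≤ (4 * C * Λ ^ q⁻¹) ^ q := by
      gcongr; linarith
    rw [Real.mul_rpow (by positivity) hb, ← Real.rpow_mul hΛ, inv_mul_cancel₀ hq.ne',
      Real.rpow_one] at h2
    have h3 : ν * X ^ q ≤ Λ := by
      calc ν * X ^ q ≤ ν * ((4 * C) ^ q * Λ) := by gcongr
        _ = ν * (4 * C) ^ q * Λ := by ring
        _ ≤ 1 * Λ := by gcongr
        _ = Λ := one_mul _
    linarith [Real.exp_le_exp.2 h3, Real.exp_pos (μ * a ^ q)]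
  · have h2 : X ^ q ≤ (2 * a) ^ q := by
      gcongr; linarith
    have h3 : (2 : ℝ) ^ q ≤ 2 := by
      simpa using Real.rpow_le_rpow_of_exponent_le (x := 2) (by norm_num) hq1
    rw [Real.mul_rpow (by norm_num) ha] at h2
    have h4 : ν * X ^ q ≤ μ * a ^ q := by
      calc ν * X ^ q ≤ μ / 2 * (2 * a ^ q) := by
            gcongr
            exact h2.trans (by gcongr)
        _ = μ * a ^ q := by ring
    linarith [Real.exp_le_exp.2 h4, Real.exp_pos Λ]

/-- for `α > 0`, the operator `Ť` maps `L_exp^α` into `L_exp^(α+1)`: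
if `f ∈ L_exp^α` then `f/w ∈ L¹(-1,1)` and `Ť f = -w T(f/w) ∈ L_exp^(α+1)`. -/
theorem stmt5 (α : ℝ) (hα : 0 < α) (f : ℝ → ℂ) (hf : MemLexpPow α f) :
    MeasureTheory.Integrable (fun x => f x / (w x : ℂ)) mIoo ∧
      MemLexpPow (α + 1) (Tcheck f) := by
  have hfi := hf.integrable hα
  have hfw : Integrable (fun x => f x / (w x : ℂ)) mIoo := by
    refine (hf.integrable_div_w hα).mono' (hf.1.div₀
      (Complex.measurable_ofReal.comp measurable_w).aestronglyMeasurable) ?_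
    filter_upwards with x
    have h0 : 0 ≤ w x := Real.sqrt_nonneg _
    rw [norm_div, Complex.norm_real, Real.norm_of_nonneg h0]
  refine ⟨hfw, ?_, ?_⟩
  · exact ((Complex.measurable_ofReal.comp measurable_w).aestronglyMeasurable.mul
      (aestronglyMeasurable_FHT hfw)).neg
  obtain ⟨μ, hμ, K, hK, hbound⟩ := hf.exists_lintegral_exp_hilbertMaj_le hα hfi
  obtain ⟨C, hC, hS⟩ := hf.exists_stieltjes_le hα
  set q : ℝ := 1 / (α + 1) with hq
  have hq0 : 0 < q := by positivity
  have hq1 : q ≤ 1 := by rw [hq, div_le_one (by linarith)]; linarith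
  have hqi : q⁻¹ = α + 1 := by rw [hq, one_div, inv_inv]
  have hCq : 0 < (4 * C) ^ q := by positivity
  set ν := min (μ / 2) ((4 * C) ^ q)⁻¹
  have hν : 0 < ν := by positivity
  have hνμ : ν ≤ μ / 2 := min_le_left _ _
  have hνC : ν * (4 * C) ^ q ≤ 1 := by
    calc ν * (4 * C) ^ q ≤ ((4 * C) ^ q)⁻¹ * (4 * C) ^ q := by gcongr; exact min_le_right _ _
      _ = 1 := inv_mul_cancel₀ hCq.ne'
  refine ⟨ν, hν, ?_⟩
  set c₀ : ℂ := Classical.choice inferInstance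
  set e : ℕ → ℝ := fun k => 1 / ((k : ℝ) + 1) with he
  have he0 : ∀ k, 0 < e k := fun k => by simp only [he]; positivity
  have hlim : Tendsto e atTop (nhdsWithin (0 : ℝ) (Set.Ioi 0)) :=
    tendsto_nhdsWithin_iff.2 ⟨tendsto_one_div_add_atTop_nhds_zero_nat, Eventually.of_forall he0⟩
  set H : ℕ → ℝ → ENNReal := fun k t =>
    ENNReal.ofReal (Real.exp (μ * |hilbertMaj f (e k) t| ^ q)) +
      ENNReal.ofReal (Real.exp (1 - Real.log (w t))) with hH
  have hHm1 : ∀ k, Measurable fun t =>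
      ENNReal.ofReal (Real.exp (μ * |hilbertMaj f (e k) t| ^ q)) := fun k => by
    have := (continuous_hilbertMaj hfi (he0 k)).measurable
    fun_prop
  have hHm2 : Measurable fun t => ENNReal.ofReal (Real.exp (1 - Real.log (w t))) := by
    have := measurable_w
    fun_prop
  have hpt : ∀ᵐ t ∂mIoo, ENNReal.ofReal (Real.exp (ν * ‖Tcheck f t‖ ^ q)) ≤
      ENNReal.ofReal (Real.exp (ν * ‖c₀‖ ^ q)) + liminf (fun k => H k t) atTop := by
    filter_upwards [ae_mem_Ioo_mIoo] with t ht
    have hv := w_pos ht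
    have hv1 := w_le_one t
    have hT : ‖Tcheck f t‖ = w t * ‖FHT (fun y => f y / (w y : ℂ)) t‖ := by
      rw [Tcheck, norm_neg, norm_mul, Complex.norm_real, Real.norm_of_nonneg hv.le]
    rw [FHT_eq_limUnder_truncInt hfw ht] at hT
    by_cases h : ∃ c, Tendsto (fun ε => (Real.pi : ℂ)⁻¹ *
        truncInt (fun y => f y / (w y : ℂ)) ε t) (nhdsWithin (0 : ℝ) (Set.Ioi 0)) (nhds c)
    · obtain ⟨c, hc⟩ := h
      rw [hc.limUnder_eq] at hT
      have hcont : Continuous fun z : ℂ => ENNReal.ofReal (Real.exp (ν * (w t * ‖z‖) ^ q)) := by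
        refine ENNReal.continuous_ofReal.comp (Real.continuous_exp.comp (continuous_const.mul ?_))
        exact (by fun_prop : Continuous fun z : ℂ => w t * ‖z‖).rpow_const fun _ => Or.inr hq0.le
      have hl := (hcont.tendsto c).comp (hc.comp hlim)
      rw [hT, ← hl.liminf_eq]
      refine le_add_left (liminf_le_liminf (Eventually.of_forall fun k => ?_))
      simp only [Function.comp_apply, hH]
      rw [← ENNReal.ofReal_add (Real.exp_pos _).le (Real.exp_pos _).le]
      refine ENNReal.ofReal_le_ofReal ?_
      have hlog : Real.log (w t) ≤ 0 := Real.log_nonpos hv.le hv1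
      refine exp_mul_rpow_le hq0 hq1 hμ hC hν hνμ hνC (by positivity) (abs_nonneg _) (by linarith)
        ?_
      have hb := w_mul_norm_truncInt_le hfi hfw (he0 k) ht (hS t ht).1
      have hpi : ‖(Real.pi : ℂ)⁻¹‖ ≤ 1 := by
        rw [norm_inv, Complex.norm_real, Real.norm_of_nonneg Real.pi_pos.le]
        exact inv_le_one_of_one_le₀ (by linarith [Real.pi_gt_three])
      rw [hqi]
      calc w t * ‖(Real.pi : ℂ)⁻¹ * truncInt (fun y => f y / (w y : ℂ)) (e k) t‖
          ≤ w t * (1 * ‖truncInt (fun y => f y / (w y : ℂ)) (e k) t‖) := by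
            rw [norm_mul]; gcongr
        _ ≤ _ := by
            rw [one_mul]
            linarith [(hS t ht).2, le_abs_self (hilbertMaj f (e k) t)]
    · rw [limUnder_of_not_tendsto h] at hT
      have hle : ‖Tcheck f t‖ ≤ ‖c₀‖ := by
        rw [hT]; exact mul_le_of_le_one_left (norm_nonneg _) hv1
      refine le_add_right (ENNReal.ofReal_le_ofReal ?_)
      gcongr
  refine (lintegral_mono_ae hpt).trans_lt ?_
  rw [lintegral_add_left measurable_const, lintegral_const]
  have hfat : ∫⁻ t, liminf (fun k => H k t) atTop ∂mIoo ≤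
      K + ∫⁻ t, ENNReal.ofReal (Real.exp (1 - Real.log (w t))) ∂mIoo := by
    refine (lintegral_liminf_le fun k => (hHm1 k).add hHm2).trans ?_
    refine liminf_le_of_le (by isBoundedDefault) fun b hb => ?_
    obtain ⟨k, hk⟩ := hb.exists
    refine hk.trans ?_
    simp only [Pi.add_apply]
    rw [lintegral_add_left (hHm1 k)]
    gcongr
    exact hbound _ (he0 k)
  refine ENNReal.add_lt_top.2 ⟨ENNReal.mul_lt_top ENNReal.ofReal_lt_top (measure_lt_top _ _),
    hfat.trans_lt (ENNReal.add_lt_top.2 ⟨hK.lt_top, lintegral_exp_log_w_lt_top⟩)⟩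
end
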